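/- (Discrete parabolic Calderón–Zygmund estimate.) In the setting of the discrete heat kernel G, for every p>1 there is a constant N, depending only on p, d, d₁, ρ, δ₁*, δ₂* and the vectors l₁,…,l_{d₁}, such that for every finitely supported f : ℤ×ℤ^d→ℝ one has Σ_{n∈ℤ} ( [ Σ_{j=−∞}^{n−1} G(j,n,·)∗f(j,·) ]_{2,p;1} )^p ≤ N Σ_{(j,x)∈ℤ×ℤ^d} |f(j,x)|^p. -/

import Mathlib

open scoped ENNReal BigOperators

noncomputable section

/-- standard basis vector of `ℤ^d`. -/
def stdE (d : ℕ) (i : Fin d) : Fin d → ℤ := fun j => if j = i then 1 else 0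

/-- forward difference quotient `δ_{ξ,h} f (x) = (f(x+hξ) - f(x))/h`, in lattice
representation (a function on `hℤ^d` is represented by its values on `ℤ^d`). -/
def fdiff {d : ℕ} (h : ℝ) (ξ : Fin d → ℤ) (f : (Fin d → ℤ) → ℝ) : (Fin d → ℤ) → ℝ :=
  fun x => (f (x + ξ) - f x) / h

/-- second difference quotient `Δ_{ξ,h} f (x) = (f(x+hξ) - 2f(x) + f(x-hξ))/h²`. -/
def sdiff {d : ℕ} (h : ℝ) (ξ : Fin d → ℤ) (f : (Fin d → ℤ) → ℝ) : (Fin d → ℤ) → ℝ :=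
  fun x => (f (x + ξ) - 2 * f x + f (x - ξ)) / h ^ 2

/-- mixed difference `δ^α_h = δ_{e_1,h}^{α_1} ⋯ δ_{e_d,h}^{α_d}`. -/
def mdiff {d : ℕ} (h : ℝ) (α : Fin d → ℕ) (f : (Fin d → ℤ) → ℝ) : (Fin d → ℤ) → ℝ :=
  (List.finRange d).foldr (fun i g => (fdiff h (stdE d i))^[α i] g) f

/-- discrete `l_p` norm `‖f‖_{p;h} = (h^d Σ_x |f(x)|^p)^{1/p}`. -/
def lpN {d : ℕ} (p h : ℝ) (f : (Fin d → ℤ) → ℝ) : ℝ≥0∞ :=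
  (ENNReal.ofReal h ^ d * ∑' x : Fin d → ℤ, ENNReal.ofReal (|f x| ^ p)) ^ (1 / p)

/-- discrete Sobolev seminorm `[f]_{s,p;h} = Σ_{|α|=s} ‖δ^α_h f‖_{p;h}`. -/
def semiN {d : ℕ} (p h : ℝ) (s : ℕ) (f : (Fin d → ℤ) → ℝ) : ℝ≥0∞ :=
  ∑ α ∈ Finset.univ.filter (fun α : Fin d → Fin (s + 1) => (∑ i, (α i : ℕ)) = s),
    lpN p h (mdiff h (fun i => (α i : ℕ)) f)

/-- discrete Sobolev norm `‖f‖_{s,p;h} = Σ_{n=0}^s [f]_{n,p;h}`. -/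
def sobN {d : ℕ} (p h : ℝ) (s : ℕ) (f : (Fin d → ℤ) → ℝ) : ℝ≥0∞ :=
  ∑ m ∈ Finset.range (s + 1), semiN p h m f

abbrev RR (d : ℕ) := AddMonoidAlgebra ℝ (Fin d → ℤ)

def tau {d : ℕ} (x : Fin d → ℤ) : RR d := AddMonoidAlgebra.single x 1

def prg {d : ℕ} (φ : (Fin d → ℤ) → ℝ) : RR d →ₗ[ℝ] ℝ where
  toFun u := u.coeff.sum fun x c => c * φ x
  map_add' u v := by
    rw [AddMonoidAlgebra.coeff_add]
    exact Finsupp.sum_add_index' (by simp) (by intros; ring)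
  map_smul' r u := by
    rw [AddMonoidAlgebra.coeff_smul, Finsupp.sum_smul_index' (by simp)]
    simp [Finsupp.sum, Finset.mul_sum, mul_assoc]

lemma prg_def {d : ℕ} (φ : (Fin d → ℤ) → ℝ) (u : RR d) :
    prg φ u = u.coeff.sum fun x c => c * φ x := rfl

@[simp] lemma prg_single {d : ℕ} (φ : (Fin d → ℤ) → ℝ) (x : Fin d → ℤ) (c : ℝ) :
    prg φ (AddMonoidAlgebra.single x c) = c * φ x := by
  rw [prg_def, AddMonoidAlgebra.coeff_single, Finsupp.sum_single_index (by simp)]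

@[simp] lemma prg_tau {d : ℕ} (φ : (Fin d → ℤ) → ℝ) (x : Fin d → ℤ) :
    prg φ (tau x) = φ x := by simp [tau]

lemma tau_zero {d : ℕ} : (tau 0 : RR d) = 1 := rfl

lemma tau_add {d : ℕ} (x y : Fin d → ℤ) : (tau (x + y) : RR d) = tau x * tau y := by
  simp [tau, AddMonoidAlgebra.single_mul_single]

@[simp] lemma prg_one {d : ℕ} (φ : (Fin d → ℤ) → ℝ) : prg φ (1 : RR d) = φ 0 := by
  rw [← tau_zero, prg_tau]

lemma prg_fadd {d : ℕ} (φ ψ : (Fin d → ℤ) → ℝ) (u : RR d) :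
    prg (fun x => φ x + ψ x) u = prg φ u + prg ψ u := by
  simp [prg_def, Finsupp.sum, mul_add, Finset.sum_add_distrib]

lemma prg_fsmul {d : ℕ} (c : ℝ) (φ : (Fin d → ℤ) → ℝ) (u : RR d) :
    prg (fun x => c * φ x) u = c * prg φ u := by
  simp only [prg_def, Finsupp.sum, Finset.mul_sum]
  refine Finset.sum_congr rfl fun x _ => by ring

lemma prg_fsum {d : ℕ} {ι : Type*} (s : Finset ι) (φ : ι → (Fin d → ℤ) → ℝ) (u : RR d) :
    prg (fun x => ∑ i ∈ s, φ i x) u = ∑ i ∈ s, prg (φ i) u := by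
  simp only [prg_def, Finsupp.sum, Finset.mul_sum]
  exact Finset.sum_comm

lemma prg_mul {d : ℕ} (φ : (Fin d → ℤ) → ℝ) (u v : RR d) :
    prg φ (u * v) = prg (fun x => prg (fun y => φ (x + y)) v) u := by
  induction u using AddMonoidAlgebra.induction_linear with
  | zero => simp
  | add a b ha hb => simp [add_mul, ha, hb]
  | single x c =>
    induction v using AddMonoidAlgebra.induction_linear with
    | zero => simp
    | add a b ha hb => simp only [mul_add, map_add, ha, hb, prg_single]
    | single y e => simp [AddMonoidAlgebra.single_mul_single, mul_assoc]

def Posi {d : ℕ} (u : RR d) : Prop := ∀ φ : (Fin d → ℤ) → ℝ, (∀ x, 0 ≤ φ x) → 0 ≤ prg φ u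

lemma Posi.add {d : ℕ} {u v : RR d} (hu : Posi u) (hv : Posi v) : Posi (u + v) := fun φ h => by
  rw [map_add]; exact add_nonneg (hu φ h) (hv φ h)
lemma Posi.mul {d : ℕ} {u v : RR d} (hu : Posi u) (hv : Posi v) : Posi (u * v) := fun φ h => by
  rw [prg_mul]; exact hu _ fun x => hv _ fun y => h _
lemma Posi.smul {d : ℕ} {u : RR d} {c : ℝ} (hc : 0 ≤ c) (hu : Posi u) : Posi (c • u) :=
  fun φ h => by
    rw [map_smul]; exact mul_nonneg hc (hu φ h)
lemma Posi.tau {d : ℕ} (x : Fin d → ℤ) : Posi (tau x) := fun φ h => by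
  rw [prg_tau]; exact h x
lemma Posi.one {d : ℕ} : Posi (1 : RR d) := Posi.tau 0
lemma Posi.sum {d : ℕ} {ι : Type*} (s : Finset ι) (u : ι → RR d) (h : ∀ i ∈ s, Posi (u i)) :
    Posi (∑ i ∈ s, u i) := fun φ hφ => by
  rw [map_sum]; exact Finset.sum_nonneg fun i hi => h i hi φ hφ
lemma Posi.prod {d : ℕ} {ι : Type*} (s : Finset ι) (u : ι → RR d) (h : ∀ i ∈ s, Posi (u i)) :
    Posi (∏ i ∈ s, u i) := by
  classical
  induction s using Finset.induction_on with
  | empty => simpa using Posi.one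
  | insert a s ha ih =>
    rw [Finset.prod_insert ha]
    exact (h a (by simp)).mul (ih fun i hi => h i (by simp [hi]))
lemma Posi.pow {d : ℕ} {u : RR d} (hu : Posi u) (m : ℕ) : Posi (u ^ m) := by
  induction m with
  | zero => simpa using Posi.one
  | succ m ih => rw [pow_succ]; exact ih.mul hu
lemma Posi.mono {d : ℕ} {u : RR d} (hu : Posi u) {φ ψ : (Fin d → ℤ) → ℝ} (h : ∀ x, φ x ≤ ψ x) :
    prg φ u ≤ prg ψ u := by
  have := hu (fun x => ψ x + (-1) * φ x) (fun x => by linarith [h x])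
  rw [prg_fadd, prg_fsmul] at this
  linarith
lemma Posi.cs {d : ℕ} {u : RR d} (hu : Posi u) (φ : (Fin d → ℤ) → ℝ) :
    prg φ u ^ 2 ≤ prg (fun _ => 1) u * prg (fun x => φ x ^ 2) u := by
  have key : ∀ t : ℝ, 0 ≤ prg (fun _ => 1) u * (t * t) + (2 * prg φ u) * t
      + prg (fun x => φ x ^ 2) u := by
    intro t
    have := hu (fun x => (t * t) * 1 + ((2 * t) * φ x + φ x ^ 2)) (fun x => by nlinarith [sq_nonneg (t + φ x)])
    rw [prg_fadd, prg_fadd, prg_fsmul, prg_fsmul (φ := φ)] at this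
    linarith
  have := discrim_le_zero key
  rw [discrim] at this
  nlinarith

/-- Fisher-type domination. -/
def Fish {d : ℕ} (q P : RR d) (I : ℝ) : Prop :=
  ∀ φ : (Fin d → ℤ) → ℝ, prg φ q ^ 2 ≤ I * prg (fun x => φ x ^ 2) P

lemma Fish.add {d : ℕ} {q₁ q₂ P₁ P₂ : RR d} {I₁ I₂ : ℝ} (h₁ : Fish q₁ P₁ I₁) (h₂ : Fish q₂ P₂ I₂)
    (hI₁ : 0 ≤ I₁) (hI₂ : 0 ≤ I₂) (hP₁ : Posi P₁) (hP₂ : Posi P₂) :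
    Fish (q₁ + q₂) (P₁ + P₂) (I₁ + I₂) := fun φ => by
  rw [map_add, map_add]
  have a := h₁ φ
  have b := h₂ φ
  have pa := hP₁ (fun x => φ x ^ 2) fun _ => sq_nonneg _
  have pb := hP₂ (fun x => φ x ^ 2) fun _ => sq_nonneg _
  set x := prg φ q₁
  set y := prg φ q₂
  set P := prg (fun x => φ x ^ 2) P₁
  set Q := prg (fun x => φ x ^ 2) P₂
  have h2 : 2 * (x * y) ≤ I₁ * Q + I₂ * P := by
    apply le_of_sq_le_sq' _ (by positivity)
    have : (x * y) ^ 2 ≤ (I₁ * P) * (I₂ * Q) := by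
      rw [mul_pow]; exact mul_le_mul a b (sq_nonneg _) (by positivity)
    nlinarith [sq_nonneg (I₁ * Q - I₂ * P)]
  nlinarith
where
  le_of_sq_le_sq' {a b : ℝ} (h : a ^ 2 ≤ b ^ 2) (hb : 0 ≤ b) : a ≤ b := by
    exact le_of_abs_le (by simpa [abs_of_nonneg hb] using sq_le_sq.1 h)

lemma Fish.conv {d : ℕ} {q P B : RR d} {I : ℝ} (h : Fish q P I) (hB : Posi B) :
    Fish (B * q) (B * P) (prg (fun _ => 1) B * I) := fun φ => by
  rw [prg_mul, prg_mul]
  refine (hB.cs _).trans ?_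
  rw [mul_assoc]
  refine mul_le_mul_of_nonneg_left ?_ (hB _ fun _ => zero_le_one)
  rw [← prg_fsmul]
  exact hB.mono fun x => h _

lemma Fish.mono {d : ℕ} {q P : RR d} {I J : ℝ} (h : Fish q P I) (hIJ : I ≤ J) (hP : Posi P) :
    Fish q P J := fun φ => (h φ).trans
  (mul_le_mul_of_nonneg_right hIJ (hP _ fun _ => sq_nonneg _))

lemma Fish.smul {d : ℕ} {q P : RR d} {I : ℝ} (h : Fish q P I) (c : ℝ) :
    Fish (c • q) P (c ^ 2 * I) := fun φ => by
  rw [map_smul, smul_eq_mul, mul_pow, mul_assoc]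
  exact mul_le_mul_of_nonneg_left (h φ) (sq_nonneg _)

def Aav {d : ℕ} (e : Fin d → ℤ) : RR d := (1 / 2 : ℝ) • (1 + tau e)

lemma Aav_pos {d : ℕ} (e : Fin d → ℤ) : Posi (Aav e) :=
  Posi.smul (by norm_num) (Posi.one.add (Posi.tau e))

lemma fish_base {d : ℕ} (e : Fin d → ℤ) (m : ℕ) : ∀ c : ℝ,
    Fish ((m : ℝ) • ((1 / 2 : ℝ) • (tau e - 1) * Aav e ^ (m - 1)) + c • Aav e ^ m) (Aav e ^ m)
      (m + c ^ 2) := by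
  induction m with
  | zero =>
    intro c φ
    simp
    nlinarith
  | succ m ih =>
    intro c
    have hA := Aav_pos e
    have h1 := (ih (c - 1)).conv (B := (1 / 2 : ℝ) • (1 : RR d)) (Posi.one.smul (by norm_num))
    have h2 := (ih (c + 1)).conv (B := (1 / 2 : ℝ) • tau e) ((Posi.tau e).smul (by norm_num))
    have h3 := h1.add h2 (by simp; positivity) (by simp; positivity)
      ((Posi.one.smul (by norm_num)).mul (hA.pow m)) (((Posi.tau e).smul (by norm_num)).mul (hA.pow m))
    convert h3 using 1
    · rcases m with _ | m
      · simp only [Aav, Algebra.smul_def, Nat.cast_zero, map_zero, zero_add, Nat.cast_one, map_one,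
          pow_zero, map_add, map_sub, Nat.sub_self, pow_one]
        ring
      · simp only [Nat.add_sub_cancel, pow_succ]
        rw [Aav]
        simp only [Algebra.smul_def]
        simp
        ring
    · rw [← add_mul, ← smul_add, pow_succ']; rfl
    · simp; ring

lemma fish_A {d : ℕ} (e : Fin d → ℤ) (m : ℕ) :
    Fish ((tau e - 1) * Aav e ^ m) (Aav e ^ (m + 1)) (4 / (m + 1)) := by
  have h := (fish_base e (m + 1) 0).smul (2 / (m + 1))
  have hm : (m + 1 : ℝ) ≠ 0 := by positivity
  convert h using 1
  · simp only [zero_smul, add_zero, Nat.add_sub_cancel, smul_smul, smul_mul_assoc, Nat.cast_add, Nat.cast_one]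
    rw [show (2 / ((m : ℝ) + 1) * ((m + 1) * (1 / 2))) = 1 by field_simp, one_smul]
  · push_cast; field_simp; norm_num

lemma fish_prod {d : ℕ} {ι : Type*} (e : Fin d → ℤ) (ε : ℝ) (hε : 0 ≤ ε) (S : ι → RR d)
    (hS : ∀ i, Posi (S i - ε • (1 + tau e))) (hm : ∀ i, prg (fun _ => 1) (S i) = 1)
    (s : Finset ι) : ∀ m : ℕ,
    Fish ((tau e - 1) * Aav e ^ m * ∏ i ∈ s, S i) (Aav e ^ (m + 1) * ∏ i ∈ s, S i)
      (4 / (m + 1 + ε * s.card)) := by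
  classical
  have hA := Aav_pos e
  have hSp : ∀ i, Posi (S i) := fun i => by
    have := (hS i).add ((Posi.one.add (Posi.tau e)).smul hε)
    simpa using this
  induction s using Finset.induction_on with
  | empty => intro m; simpa using fish_A e m
  | insert a s ha ih =>
    intro m
    have hP := Posi.prod s S fun i _ => hSp i
    have h1 := (ih (m + 1)).conv (B := (2 * ε) • (1 : RR d)) (Posi.one.smul (by positivity))
    have h2 := (ih m).conv (hS a)
    have e1 : prg (fun _ => 1) ((2 * ε) • (1 : RR d)) = 2 * ε := by simp
    have e2 : prg (fun _ => 1) (S a - ε • (1 + tau e)) = 1 - 2 * ε := by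
      simp [hm]; ring
    have e3 : 0 ≤ 1 - 2 * ε := by rw [← e2]; exact hS a _ fun _ => zero_le_one
    rw [e1] at h1
    rw [e2] at h2
    have h3 := h1.add h2 (by positivity) (by positivity)
      ((Posi.one.smul (by positivity)).mul ((hA.pow _).mul hP)) ((hS a).mul ((hA.pow _).mul hP))
    have e4 : (ε • (1 + tau e) : RR d) = (2 * ε) • Aav e := by
      rw [Aav, smul_smul]; congr 1; ring
    rw [Finset.prod_insert ha, Finset.card_insert_of_notMem ha]
    have h4 := h3.mono (J := 4 / (m + 1 + ε * ((s.card + 1 : ℕ) : ℝ))) ?_ ?_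
    · convert h4 using 1
      · rw [e4, Algebra.smul_def, Algebra.smul_def]; ring
      · rw [e4, Algebra.smul_def, Algebra.smul_def]; ring
    · push_cast
      set t : ℝ := m + 1 + ε * s.card with ht
      have ht1 : 1 ≤ t := by
        have : 0 ≤ ε * s.card := by positivity
        have : (0 : ℝ) ≤ m := by positivity
        linarith
      rw [show (m : ℝ) + 1 + 1 + ε * s.card = t + 1 by rw [ht]; ring,
        show (m : ℝ) + 1 + ε * (s.card + 1) = t + ε by rw [ht]; ring]
      rw [← sub_nonneg]
      have : 4 / (t + ε) - (2 * ε * (4 / (t + 1)) + (1 - 2 * ε) * (4 / t))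
          = 4 * ε * (t - 1 + 2 * ε) / (t * (t + 1) * (t + ε)) := by
        field_simp; ring
      rw [this]
      apply div_nonneg _ (by positivity)
      apply mul_nonneg (by positivity) (by linarith)
    · have := (Posi.one.smul (show 0 ≤ 2 * ε by positivity)).mul ((hA.pow (m + 1 + 1)).mul hP)
      exact this.add ((hS a).mul ((hA.pow _).mul hP))

def wn {d : ℕ} (φ : (Fin d → ℤ) → ℝ) (u : RR d) : ℝ := u.coeff.sum fun x c => |c| * φ x

lemma wn_eq {d : ℕ} (φ : (Fin d → ℤ) → ℝ) (u : RR d) :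
    wn φ u = prg (fun x => Real.sign (u.coeff x) * φ x) u := by
  simp only [wn, prg_def, Finsupp.sum]
  refine Finset.sum_congr rfl fun x _ => ?_
  rcases lt_trichotomy (u.coeff x) 0 with h | h | h
  · rw [Real.sign_of_neg h, abs_of_neg h]; ring
  · simp [h]
  · rw [Real.sign_of_pos h, abs_of_pos h]; ring

lemma wn_mono {d : ℕ} {φ ψ : (Fin d → ℤ) → ℝ} (u : RR d) (h : ∀ x, φ x ≤ ψ x) :
    wn φ u ≤ wn ψ u :=
  Finset.sum_le_sum fun x _ => mul_le_mul_of_nonneg_left (h x) (abs_nonneg _)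

lemma wn_nonneg {d : ℕ} {φ : (Fin d → ℤ) → ℝ} (u : RR d) (h : ∀ x, 0 ≤ φ x) :
    0 ≤ wn φ u :=
  Finset.sum_nonneg fun x _ => mul_nonneg (abs_nonneg _) (h x)

lemma wn_fadd {d : ℕ} (φ ψ : (Fin d → ℤ) → ℝ) (u : RR d) :
    wn (fun x => φ x + ψ x) u = wn φ u + wn ψ u := by
  simp [wn, Finsupp.sum, mul_add, Finset.sum_add_distrib]

lemma wn_fsmul {d : ℕ} (c : ℝ) (φ : (Fin d → ℤ) → ℝ) (u : RR d) :
    wn (fun x => c * φ x) u = c * wn φ u := by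
  simp only [wn, Finsupp.sum, Finset.mul_sum]
  refine Finset.sum_congr rfl fun x _ => by ring

lemma abs_sign_le (c : ℝ) : |Real.sign c| ≤ 1 := by
  rcases Real.sign_apply_eq c with h | h | h <;> simp [h]

lemma abs_prg_le {d : ℕ} (φ : (Fin d → ℤ) → ℝ) (u : RR d) :
    |prg φ u| ≤ wn (fun x => |φ x|) u := by
  simp only [wn, prg_def, Finsupp.sum]
  refine (Finset.abs_sum_le_sum_abs _ _).trans (le_of_eq ?_)
  exact Finset.sum_congr rfl fun x _ => abs_mul _ _

lemma prg_sign_le {d : ℕ} {φ : (Fin d → ℤ) → ℝ} (hφ : ∀ x, 0 ≤ φ x) (t : (Fin d → ℤ) → ℝ)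
    (u : RR d) : |prg (fun x => Real.sign (t x) * φ x) u| ≤ wn φ u := by
  refine (abs_prg_le _ _).trans (wn_mono _ fun x => ?_)
  rw [abs_mul, abs_of_nonneg (hφ x)]
  exact mul_le_of_le_one_left (hφ x) (abs_sign_le _)

lemma wn_add {d : ℕ} {φ : (Fin d → ℤ) → ℝ} (hφ : ∀ x, 0 ≤ φ x) (u v : RR d) :
    wn φ (u + v) ≤ wn φ u + wn φ v := by
  rw [wn_eq, map_add]
  exact add_le_add (le_of_abs_le (prg_sign_le hφ _ u)) (le_of_abs_le (prg_sign_le hφ _ v))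

lemma wn_smul {d : ℕ} (φ : (Fin d → ℤ) → ℝ) (c : ℝ) (u : RR d) :
    wn φ (c • u) = |c| * wn φ u := by
  simp only [wn]
  rw [AddMonoidAlgebra.coeff_smul, Finsupp.sum_smul_index' (by simp)]
  simp [Finsupp.sum, Finset.mul_sum, mul_assoc, abs_mul]

lemma wn_neg {d : ℕ} (φ : (Fin d → ℤ) → ℝ) (u : RR d) : wn φ (-u) = wn φ u := by
  have := wn_smul φ (-1) u
  simpa using this

lemma wn_zero {d : ℕ} (φ : (Fin d → ℤ) → ℝ) : wn φ (0 : RR d) = 0 := by simp [wn]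

lemma wn_sum {d : ℕ} {φ : (Fin d → ℤ) → ℝ} (hφ : ∀ x, 0 ≤ φ x) {ι : Type*} (s : Finset ι)
    (u : ι → RR d) : wn φ (∑ i ∈ s, u i) ≤ ∑ i ∈ s, wn φ (u i) :=
  Finset.le_sum_of_subadditive _ (wn_zero φ).le (wn_add hφ) _ _

lemma wn_mul {d : ℕ} {φ : (Fin d → ℤ) → ℝ} (hφ : ∀ x, 0 ≤ φ x) (u v : RR d) :
    wn φ (u * v) ≤ wn (fun x => wn (fun y => φ (x + y)) v) u := by
  rw [wn_eq, prg_mul]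
  refine (le_abs_self _).trans ((abs_prg_le _ _).trans (wn_mono _ fun x => ?_))
  exact prg_sign_le (φ := fun y => φ (x + y)) (fun y => hφ _)
    (fun y => (u * v).coeff (x + y)) v

def nm {d : ℕ} (u : RR d) : ℝ := wn (fun _ => 1) u
def l1 {d : ℕ} (x : Fin d → ℤ) : ℝ := ∑ i, |(x i : ℝ)|
def wt {d : ℕ} (u : RR d) : ℝ := wn l1 u

lemma l1_nonneg {d : ℕ} (x : Fin d → ℤ) : 0 ≤ l1 x := Finset.sum_nonneg fun _ _ => abs_nonneg _
lemma l1_add {d : ℕ} (x y : Fin d → ℤ) : l1 (x + y) ≤ l1 x + l1 y := by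
  simp only [l1, ← Finset.sum_add_distrib]
  refine Finset.sum_le_sum fun i _ => ?_
  simp only [Pi.add_apply, Int.cast_add]
  exact abs_add_le _ _

lemma nm_nonneg {d : ℕ} (u : RR d) : 0 ≤ nm u := wn_nonneg _ fun _ => zero_le_one
lemma wt_nonneg {d : ℕ} (u : RR d) : 0 ≤ wt u := wn_nonneg _ l1_nonneg

lemma nm_mul {d : ℕ} (u v : RR d) : nm (u * v) ≤ nm u * nm v := by
  refine (wn_mul (fun _ => zero_le_one) u v).trans (le_of_eq ?_)
  have := wn_fsmul (nm v) (fun _ => 1) u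
  rw [mul_comm (nm u)]
  simp only [mul_one] at this
  exact this

lemma wt_mul {d : ℕ} (u v : RR d) : wt (u * v) ≤ wt u * nm v + nm u * wt v := by
  refine (wn_mul l1_nonneg u v).trans ?_
  have h1 : ∀ x, wn (fun y => l1 (x + y)) v ≤ nm v * l1 x + wt v * 1 := fun x => by
    have h2 := wn_mono v (l1_add x)
    rw [wn_fadd] at h2
    have h3 := wn_fsmul (l1 x) (fun _ => 1) v
    simp only [mul_one] at h3
    rw [h3] at h2
    refine h2.trans (le_of_eq ?_)
    simp only [nm, wt]; ring
  refine (wn_mono u h1).trans (le_of_eq ?_)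
  rw [wn_fadd, wn_fsmul, wn_fsmul]
  simp only [nm, wt]; ring

lemma wn_tau {d : ℕ} (φ : (Fin d → ℤ) → ℝ) (x : Fin d → ℤ) : wn φ (tau x) = φ x := by
  simp only [wn, tau]
  rw [AddMonoidAlgebra.coeff_single, Finsupp.sum_single_index (by simp)]; simp

lemma nm_tau_mul {d : ℕ} (x : Fin d → ℤ) (u : RR d) : nm (tau x * u) ≤ nm u := by
  refine (nm_mul _ _).trans (le_of_eq ?_)
  rw [nm, wn_tau, one_mul]

lemma tau_neg_mul {d : ℕ} (x : Fin d → ℤ) : (tau (-x) : RR d) * tau x = 1 := by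
  rw [← tau_add, neg_add_cancel, tau_zero]

lemma tau_neg_sub {d : ℕ} (x : Fin d → ℤ) (u : RR d) :
    (tau (-x) - 1) * u = -(tau (-x) * ((tau x - 1) * u)) := by
  have := tau_neg_mul x
  linear_combination (u) * this

lemma nm_neg_le {d : ℕ} (x : Fin d → ℤ) (u : RR d) :
    nm ((tau (-x) - 1) * u) ≤ nm ((tau x - 1) * u) := by
  rw [tau_neg_sub]
  simp only [nm, wn_neg]
  exact nm_tau_mul _ _

lemma wt_neg_le {d : ℕ} (x : Fin d → ℤ) (u : RR d) :
    wt ((tau (-x) - 1) * u) ≤ l1 (-x) * nm ((tau x - 1) * u) + wt ((tau x - 1) * u) := by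
  rw [tau_neg_sub]
  simp only [wt, wn_neg]
  refine (wt_mul _ _).trans (le_of_eq ?_)
  simp only [wt, nm, wn_tau]; ring

lemma nm_tau_path {d : ℕ} (u : RR d) (K : ℝ)
    (h : ∀ i, nm ((tau (stdE d i) - 1) * u) ≤ K) (v : Fin d → ℤ) :
    nm ((tau v - 1) * u) ≤ K * l1 v := by
  set g : (Fin d → ℤ) → ℝ := fun v => nm ((tau v - 1) * u) with hg
  have g0 : g 0 = 0 := by simp [hg, tau_zero, nm, wn_zero]
  have gadd : ∀ v w, g (v + w) ≤ g v + g w := fun v w => by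
    have : (tau (v + w) - 1) * u = tau v * ((tau w - 1) * u) + (tau v - 1) * u := by
      rw [tau_add]; ring
    simp only [hg]
    rw [this]
    refine (wn_add (fun _ => zero_le_one) _ _).trans ?_
    have := nm_tau_mul v ((tau w - 1) * u)
    simp only [nm] at this ⊢
    linarith
  have gn : ∀ (n : ℕ) v, g (n • v) ≤ n * g v := fun n v => by
    induction n with
    | zero => simp [g0]
    | succ n ih => rw [succ_nsmul]; push_cast; linarith [gadd (n • v) v]
  have gz : ∀ (n : ℤ) v, g (n • v) ≤ |(n : ℝ)| * g v := fun n v => by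
    obtain ⟨m, rfl | rfl⟩ := n.eq_nat_or_neg
    · simpa using gn m v
    · have h1 : g (-((m : ℤ) • v)) ≤ g ((m : ℤ) • v) := nm_neg_le _ _
      have h2 := gn m v
      simp only [neg_smul]
      simpa using h1.trans (by simpa using h2)
  have hv : v = ∑ i, v i • stdE d i := by
    ext j; simp [stdE, Finset.sum_apply]
  have := Finset.le_sum_of_subadditive g g0.le gadd Finset.univ (fun i => v i • stdE d i)
  rw [← hv] at this
  refine this.trans ?_
  rw [l1, Finset.mul_sum]
  refine Finset.sum_le_sum fun i _ => (gz _ _).trans ?_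
  rw [mul_comm]
  exact mul_le_mul_of_nonneg_right (h i) (abs_nonneg _)

lemma prg1_mul {d : ℕ} (u v : RR d) :
    prg (fun _ => 1) (u * v) = prg (fun _ => 1) u * prg (fun _ => 1) v := by
  rw [prg_mul]
  have := prg_fsmul (prg (fun _ => 1) v) (fun _ => 1) u
  simp only [mul_one] at this
  rw [this, mul_comm]

def stp {d d₁ : ℕ} (l : Fin d₁ → Fin d → ℤ) (c : Fin d₁ → ℝ) : RR d :=
  1 + ∑ k, c k • (tau (l k) + tau (-l k) - 2)

lemma stp_eq {d d₁ : ℕ} (l : Fin d₁ → Fin d → ℤ) (c : Fin d₁ → ℝ) :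
    stp l c = (1 - 2 * ∑ k, c k) • 1 + ∑ k, c k • (tau (l k) + tau (-l k)) := by
  simp only [stp, smul_sub, Finset.sum_sub_distrib, sub_smul, one_smul, Finset.mul_sum, Finset.sum_smul]
  have : ∀ k, c k • (2 : RR d) = (2 * c k) • 1 := fun k => by
    simp only [Algebra.smul_def, map_mul, mul_one, map_ofNat]; ring
  simp only [this]; ring

lemma prg_mul_tau {d : ℕ} (φ : (Fin d → ℤ) → ℝ) (x : Fin d → ℤ) (u : RR d) :
    prg φ (tau x * u) = prg (fun y => φ (x + y)) u := by
  rw [prg_mul, prg_tau]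

lemma prg_stp_mul {d d₁ : ℕ} (l : Fin d₁ → Fin d → ℤ) (c : Fin d₁ → ℝ) (φ : (Fin d → ℤ) → ℝ)
    (u : RR d) : prg φ (stp l c * u) = prg φ u + ∑ k, c k * prg (fun y => φ (l k + y) + φ (-l k + y)
      + (-2) * φ y) u := by
  rw [stp, add_mul, one_mul, map_add, Finset.sum_mul, map_sum]
  congr 1
  refine Finset.sum_congr rfl fun k _ => ?_
  rw [smul_mul_assoc, map_smul, sub_mul, add_mul, map_sub, map_add, prg_mul_tau, prg_mul_tau,
    prg_fadd, prg_fadd, prg_fsmul, smul_eq_mul, two_mul, map_add]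
  ring

lemma prg1_stp {d d₁ : ℕ} (l : Fin d₁ → Fin d → ℤ) (c : Fin d₁ → ℝ) :
    prg (fun _ => 1) (stp l c) = 1 := by
  have := prg_stp_mul l c (fun _ => 1) 1
  rw [mul_one] at this
  rw [this]; norm_num

lemma stp_sub_pos {d d₁ : ℕ} (l : Fin d₁ → Fin d → ℤ) (c : Fin d₁ → ℝ) (ε : ℝ) (hε : 0 ≤ ε)
    (hc : ∀ k, ε ≤ c k) (hs : ε ≤ 1 - 2 * ∑ k, c k) (k : Fin d₁) :
    Posi (stp l c - ε • (1 + tau (l k))) := by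
  have e : stp l c - ε • (1 + tau (l k)) = (1 - 2 * ∑ k, c k - ε) • 1 + (∑ j, c j • tau (- l j)
      + ∑ j, (c j - if j = k then ε else 0) • tau (l j)) := by
    rw [stp_eq]
    simp only [smul_add, Finset.sum_add_distrib, sub_smul, Finset.sum_sub_distrib, ite_smul, zero_smul,
      Finset.sum_ite_eq', Finset.mem_univ, if_true]
    ring
  rw [e]
  refine (Posi.one.smul (by linarith)).add ((Posi.sum _ _ fun j _ => ?_).add
    (Posi.sum _ _ fun j _ => ?_))
  · exact (Posi.tau _).smul (hε.trans (hc j))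
  · refine (Posi.tau _).smul ?_
    split_ifs
    · linarith [hc j]
    · linarith [hc j]

lemma stp_pos {d d₁ : ℕ} (l : Fin d₁ → Fin d → ℤ) (c : Fin d₁ → ℝ)
    (hc : ∀ k, 0 ≤ c k) (hs : 0 ≤ 1 - 2 * ∑ k, c k) : Posi (stp l c) := by
  rw [stp_eq]
  exact (Posi.one.smul hs).add (Posi.sum _ _ fun j _ => ((Posi.tau _).add (Posi.tau _)).smul (hc j))

lemma nm_pos {d : ℕ} {u : RR d} (hu : Posi u) : nm u = prg (fun _ => 1) u := by
  simp only [nm, wn, prg_def, Finsupp.sum]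
  refine Finset.sum_congr rfl fun x _ => ?_
  have := hu (fun y => if y = x then 1 else 0) (fun y => by split_ifs <;> simp)
  rw [abs_of_nonneg]
  simp only [prg_def, Finsupp.sum, mul_ite, mul_one, mul_zero, Finset.sum_ite_eq'] at this
  split_ifs at this
  exact this

lemma prod_mass {d d₁ : ℕ} (l : Fin d₁ → Fin d → ℤ) (c : ℤ → Fin d₁ → ℝ) (s : Finset ℤ) :
    prg (fun _ => 1) (∏ i ∈ s, stp l (c i)) = 1 := by
  induction s using Finset.induction_on with
  | empty => simp
  | insert a s ha ih => rw [Finset.prod_insert ha, prg1_mul, ih, prg1_stp]; norm_num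

lemma second_moment {d d₁ : ℕ} (l : Fin d₁ → Fin d → ℤ) (b : ℝ) (c : ℤ → Fin d₁ → ℝ)
    (hc : ∀ i k, c i k ≤ b) (P : RR d) (hP : prg (fun _ => 1) P = 1) (i : Fin d) (s : Finset ℤ) :
    prg (fun x => (x i : ℝ) ^ 2) (P * ∏ n ∈ s, stp l (c n)) ≤
      prg (fun x => (x i : ℝ) ^ 2) P + s.card * (∑ k, b * (2 * (l k i : ℝ) ^ 2)) := by
  induction s using Finset.induction_on with
  | empty => simp
  | insert a s ha ih =>
    rw [Finset.prod_insert ha, Finset.card_insert_of_notMem ha, mul_left_comm, prg_stp_mul]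
    have hm : prg (fun _ => 1) (P * ∏ n ∈ s, stp l (c n)) = 1 := by
      rw [prg1_mul, hP, prod_mass, one_mul]
    have e : ∀ k, prg (fun y => ((l k + y) i : ℝ) ^ 2 + ((-l k + y) i : ℝ) ^ 2 + (-2) * (y i : ℝ) ^ 2)
        (P * ∏ n ∈ s, stp l (c n)) = 2 * (l k i : ℝ) ^ 2 := fun k => by
      have : (fun y : Fin d → ℤ => ((l k + y) i : ℝ) ^ 2 + ((-l k + y) i : ℝ) ^ 2 + (-2) * (y i : ℝ) ^ 2)
          = fun y => (2 * (l k i : ℝ) ^ 2) * 1 := by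
        ext y; simp; ring
      rw [this, prg_fsmul, hm, mul_one]
    simp only [e]
    have : ∑ k, c a k * (2 * (l k i : ℝ) ^ 2) ≤ ∑ k, b * (2 * (l k i : ℝ) ^ 2) :=
      Finset.sum_le_sum fun k _ => mul_le_mul_of_nonneg_right (hc a k) (by positivity)
    push_cast
    linarith

lemma sign_sq_le (c : ℝ) : Real.sign c ^ 2 ≤ 1 := by
  rcases Real.sign_apply_eq c with h | h | h <;> simp [h]

lemma Fish.wn_le {d : ℕ} {q P : RR d} {I : ℝ} (h : Fish q P I) (hI : 0 ≤ I) (hP : Posi P)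
    (φ : (Fin d → ℤ) → ℝ) : wn φ q ^ 2 ≤ I * prg (fun x => φ x ^ 2) P := by
  rw [wn_eq]
  refine (h _).trans (mul_le_mul_of_nonneg_left (hP.mono fun x => ?_) hI)
  rw [mul_pow]
  exact mul_le_of_le_one_left (sq_nonneg _) (sign_sq_le _)

def WB {d₁ : ℕ} (a b : ℝ) (c : ℤ → Fin d₁ → ℝ) : Prop := ∀ i k, a ≤ c i k ∧ c i k ≤ b

lemma WB.sum_le {d₁ : ℕ} {a b : ℝ} {c : ℤ → Fin d₁ → ℝ} (h : WB a b c) (i : ℤ) :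
    ∑ k, c i k ≤ d₁ * b := by
  refine (Finset.sum_le_sum fun k _ => (h i k).2).trans ?_
  simp

def GoodX {d d₁ : ℕ} (l : Fin d₁ → Fin d → ℤ) (c : ℤ → Fin d₁ → ℝ) (C : ℝ) (X : RR d) : Prop :=
  ∀ s : Finset ℤ, nm (X * ∏ i ∈ s, stp l (c i)) ≤ C / √(s.card + 1) ∧
    wt (X * ∏ i ∈ s, stp l (c i)) ≤ C

lemma goodX_exists {d d₁ : ℕ} (l : Fin d₁ → Fin d → ℤ) (a b : ℝ) (ha : 0 < a) (hab : a ≤ b)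
    (hb : 2 * d₁ * b < 1) : ∃ C : ℝ, 0 < C ∧ ∀ c : ℤ → Fin d₁ → ℝ, WB a b c → ∀ k,
      GoodX l c C (tau (l k) - 1) ∧ GoodX l c C (tau (-l k) - 1) := by
  set ε : ℝ := min (min a (1 - 2 * d₁ * b)) 1 with hε
  have hε0 : 0 < ε := lt_min (lt_min ha (by linarith)) one_pos
  have hε1 : ε ≤ 1 := min_le_right _ _
  have hb0 : 0 ≤ b := ha.le.trans hab
  -- moment constant
  set M : Fin d₁ → ℝ := fun k => d * ∑ i, (prg (fun x => (x i : ℝ) ^ 2) (Aav (l k))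
      + ∑ k', b * (2 * (l k' i : ℝ) ^ 2)) with hM
  have hM0 : ∀ k, 0 ≤ M k := fun k => by
    have : ∀ i, 0 ≤ prg (fun x => (x i : ℝ) ^ 2) (Aav (l k)) := fun i =>
      Aav_pos _ _ fun x => sq_nonneg _
    simp only [hM]
    refine mul_nonneg (by positivity) (Finset.sum_nonneg fun i _ => add_nonneg (this i)
      (Finset.sum_nonneg fun _ _ => by positivity))
  set C₀ : ℝ := 2 / √ε + ∑ k, √(4 / ε * M k) with hC₀
  set C₁ : ℝ := (1 + ∑ k, l1 (-l k)) * C₀ + C₀ with hC₁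
  have hC₀0 : 0 < C₀ := by
    have : 0 ≤ ∑ k, √(4 / ε * M k) := Finset.sum_nonneg fun _ _ => Real.sqrt_nonneg _
    positivity
  have hL : 0 ≤ ∑ k, l1 (-l k) := Finset.sum_nonneg fun _ _ => l1_nonneg _
  have hC01 : C₀ ≤ C₁ := by nlinarith
  refine ⟨C₁, by linarith, fun c hc k => ?_⟩
  have hsp : ∀ i k, Posi (stp l (c i) - ε • (1 + tau (l k))) := fun i k => by
    refine stp_sub_pos l (c i) ε hε0.le (fun k => ?_) ?_ k
    · exact ((min_le_left _ _).trans (min_le_left _ _)).trans (hc i k).1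
    · have := hc.sum_le i
      have := (min_le_left (min a (1 - 2 * d₁ * b)) 1).trans (min_le_right _ _)
      linarith
  have hpos : ∀ i, Posi (stp l (c i)) := fun i => by
    have := (hsp i k).add ((Posi.one.add (Posi.tau (l k))).smul hε0.le)
    simpa using this
  have main : ∀ s : Finset ℤ, nm ((tau (l k) - 1) * ∏ i ∈ s, stp l (c i)) ≤ C₀ / √(s.card + 1) ∧
    wt ((tau (l k) - 1) * ∏ i ∈ s, stp l (c i)) ≤ C₀ := by
    intro s
    have hF := fish_prod (l k) ε hε0.le (fun i => stp l (c i)) (fun i => hsp i k)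
      (fun i => prg1_stp l (c i)) s 0
    simp only [pow_zero, mul_one, zero_add, pow_one, Nat.cast_zero] at hF
    have hPp : Posi (Aav (l k) * ∏ i ∈ s, stp l (c i)) :=
      (Aav_pos _).mul (Posi.prod _ _ fun i _ => hpos i)
    have hA1 : prg (fun _ => 1) (Aav (l k)) = 1 := by
      simp [Aav]; norm_num
    have hF2 := hF.mono (J := 4 / ε / (s.card + 1)) (by
      rw [div_div]
      apply div_le_div_of_nonneg_left (by norm_num) (by positivity)
      nlinarith [hε1]) hPp
    have hn := hF2.wn_le (by positivity) hPp (fun _ => 1)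
    have hw := hF2.wn_le (by positivity) hPp l1
    simp only [one_pow] at hn
    rw [prg1_mul, prod_mass, hA1, one_mul, mul_one] at hn
    constructor
    · have h1 : nm ((tau (l k) - 1) * ∏ i ∈ s, stp l (c i)) ≤ √(4 / ε / (s.card + 1)) :=
        Real.le_sqrt_of_sq_le hn
      refine h1.trans ?_
      rw [Real.sqrt_div (by positivity), Real.sqrt_div (by norm_num),
        show √(4 : ℝ) = 2 by rw [show (4 : ℝ) = 2 ^ 2 by norm_num]; exact Real.sqrt_sq (by norm_num)]
      apply div_le_div_of_nonneg_right _ (Real.sqrt_nonneg _)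
      rw [hC₀]
      have : 0 ≤ ∑ k, √(4 / ε * M k) := Finset.sum_nonneg fun _ _ => Real.sqrt_nonneg _
      linarith
    · have h2 : prg (fun x => l1 x ^ 2) (Aav (l k) * ∏ i ∈ s, stp l (c i)) ≤ (s.card + 1) * M k := by
        have h3 : ∀ x : Fin d → ℤ, l1 x ^ 2 ≤ d * ∑ i, (x i : ℝ) ^ 2 := fun x => by
          have := sq_sum_le_card_mul_sum_sq (s := Finset.univ) (f := fun i => |(x i : ℝ)|)
          simpa [l1] using this
        refine (hPp.mono h3).trans ?_
        rw [prg_fsmul, prg_fsum]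
        simp only [hM]
        rw [mul_left_comm]
        refine mul_le_mul_of_nonneg_left ?_ (by positivity)
        rw [Finset.mul_sum]
        refine Finset.sum_le_sum fun i _ => ?_
        refine (second_moment l b c (fun i k => (hc i k).2) (Aav (l k)) hA1 i s).trans ?_
        have h4 : 0 ≤ prg (fun x => (x i : ℝ) ^ 2) (Aav (l k)) := Aav_pos _ _ fun x => sq_nonneg _
        have h5 : 0 ≤ ∑ k', b * (2 * (l k' i : ℝ) ^ 2) := Finset.sum_nonneg fun _ _ => by positivity
        have h6 : (0 : ℝ) ≤ s.card := by positivity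
        nlinarith
      have h7 : wt ((tau (l k) - 1) * ∏ i ∈ s, stp l (c i)) ^ 2 ≤ 4 / ε * M k := by
        refine hw.trans ((mul_le_mul_of_nonneg_left h2 (by positivity)).trans (le_of_eq ?_))
        field_simp
      have h8 := Real.le_sqrt_of_sq_le h7
      refine h8.trans ?_
      have h9 := Finset.single_le_sum (f := fun k => √(4 / ε * M k))
        (fun k _ => Real.sqrt_nonneg _) (Finset.mem_univ k)
      have : 0 ≤ 2 / √ε := by positivity
      rw [hC₀]; linarith
  refine ⟨fun s => ⟨(main s).1.trans ?_, (main s).2.trans hC01⟩, fun s => ⟨?_, ?_⟩⟩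
  · exact div_le_div_of_nonneg_right hC01 (Real.sqrt_nonneg _)
  · refine (nm_neg_le _ _).trans ((main s).1.trans ?_)
    exact div_le_div_of_nonneg_right hC01 (Real.sqrt_nonneg _)
  · refine (wt_neg_le _ _).trans ?_
    have h1 : nm ((tau (l k) - 1) * ∏ i ∈ s, stp l (c i)) ≤ C₀ := (main s).1.trans (by
      apply div_le_self hC₀0.le
      rw [Real.one_le_sqrt]; linarith [(Nat.cast_nonneg s.card : (0 : ℝ) ≤ s.card)])
    have h2 := (main s).2
    have h3 := Finset.single_le_sum (f := fun k => l1 (-l k))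
        (fun k _ => l1_nonneg _) (Finset.mem_univ k)
    have h4 := l1_nonneg (-l k)
    have := mul_le_mul (h3) h1 (nm_nonneg _) hL
    rw [hC₁]; nlinarith

def Prd {d d₁ : ℕ} (l : Fin d₁ → Fin d → ℤ) (c : ℤ → Fin d₁ → ℝ) (j n : ℤ) : RR d :=
  ∏ i ∈ Finset.Ico j n, stp l (c i)

lemma Prd_split {d d₁ : ℕ} (l : Fin d₁ → Fin d → ℤ) (c : ℤ → Fin d₁ → ℝ) {j m n : ℤ}
    (h1 : j ≤ m) (h2 : m ≤ n) : Prd l c j n = Prd l c j m * Prd l c m n := by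
  simp only [Prd]
  rw [← Finset.prod_union (Finset.Ico_disjoint_Ico_consecutive _ _ _),
    Finset.Ico_union_Ico_eq_Ico h1 h2]

lemma GoodX.nm_le {d d₁ : ℕ} {l : Fin d₁ → Fin d → ℤ} {c : ℤ → Fin d₁ → ℝ} {C : ℝ} {X : RR d}
    (h : GoodX l c C X) (hC : 0 ≤ C) (j m : ℤ) (r : ℝ) (hr : 0 < r) (hm : r ≤ 4 * ((m - j : ℤ) + 1 : ℝ)) :
    nm (X * Prd l c j m) ≤ 2 * C / √r := by
  refine (h _).1.trans ?_
  rw [Int.card_Ico]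
  have h1 : ((m - j : ℤ) : ℝ) ≤ ((m - j).toNat : ℝ) := by exact_mod_cast Int.self_le_toNat _
  have h2 : r ≤ 4 * (((m - j).toNat : ℝ) + 1) := by linarith
  have h3 : √r ≤ 2 * √(((m - j).toNat : ℝ) + 1) := by
    refine Real.sqrt_le_iff.2 ⟨by positivity, ?_⟩
    rw [mul_pow, Real.sq_sqrt (by positivity)]; linarith
  rw [div_le_div_iff₀ (by positivity) (by positivity)]
  nlinarith

lemma nm_Prd {d d₁ : ℕ} {l : Fin d₁ → Fin d → ℤ} {c : ℤ → Fin d₁ → ℝ}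
    (hp : ∀ i, Posi (stp l (c i))) (j m : ℤ) : nm (Prd l c j m) = 1 := by
  rw [Prd, nm_pos (Posi.prod _ _ fun i _ => hp i), prod_mass]

lemma nm_mul_le {d : ℕ} {u v : RR d} {A B : ℝ} (hu : nm u ≤ A) (hv : nm v ≤ B) :
    nm (u * v) ≤ A * B :=
  (nm_mul u v).trans (mul_le_mul hu hv (nm_nonneg _) ((nm_nonneg _).trans hu))

lemma good_est {d d₁ : ℕ} {l : Fin d₁ → Fin d → ℤ} {c : ℤ → Fin d₁ → ℝ}
    (hp : ∀ i, Posi (stp l (c i))) {C : ℝ} (hC : 0 ≤ C) (j n : ℤ) (hjn : j < n) (N : ℝ)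
    (hN : N = ((n - j : ℤ) : ℝ)) {X₁ X₂ : RR d} (h₁ : GoodX l c C X₁) (h₂ : GoodX l c C X₂) :
    wt (X₁ * X₂ * Prd l c j n) ≤ 4 * C ^ 2 / √N ∧
    ∀ X₃, GoodX l c C X₃ → nm (X₁ * X₂ * X₃ * Prd l c j n) ≤ 8 * C ^ 3 / (N * √N) ∧
    ∀ X₄, GoodX l c C X₄ → nm (X₁ * X₂ * X₃ * X₄ * Prd l c j n) ≤ 16 * C ^ 4 / N ^ 2 := by
  obtain ⟨m, hm⟩ : ∃ m : ℤ, m = (n - j) / 4 := ⟨_, rfl⟩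
  have hN0 : 0 < N := by rw [hN]; exact_mod_cast (by omega : 0 < n - j)
  have hs : √N * √N = N := Real.mul_self_sqrt hN0.le
  have hs0 : 0 < √N := Real.sqrt_pos.2 hN0
  have hr : ∀ i k : ℤ, m ≤ k - i → N ≤ 4 * ((k - i : ℤ) + 1 : ℝ) := fun i k h => by
    rw [hN]; exact_mod_cast (by omega : n - j ≤ 4 * (k - i + 1))
  have e : Prd l c j n = Prd l c j (j + m) * Prd l c (j + m) (j + 2 * m) *
      Prd l c (j + 2 * m) (j + 3 * m) * Prd l c (j + 3 * m) n := by
    rw [← Prd_split l c (by omega) (by omega), ← Prd_split l c (by omega) (by omega),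
      ← Prd_split l c (by omega) (by omega)]
  refine ⟨?_, fun X₃ h₃ => ⟨?_, fun X₄ h₄ => ?_⟩⟩
  · rw [Prd_split l c (show j ≤ j + m by omega) (show j + m ≤ n by omega),
      show X₁ * X₂ * (Prd l c j (j + m) * Prd l c (j + m) n) = (X₁ * Prd l c j (j + m)) *
        (X₂ * Prd l c (j + m) n) by ring]
    refine (wt_mul _ _).trans ?_
    have a1 := h₁.nm_le hC j (j + m) N hN0 (hr _ _ (by omega))
    have a2 := h₂.nm_le hC (j + m) n N hN0 (hr _ _ (by omega))
    have b1 : wt (X₁ * Prd l c j (j + m)) ≤ C := (h₁ _).2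
    have b2 : wt (X₂ * Prd l c (j + m) n) ≤ C := (h₂ _).2
    have t1 := mul_le_mul b1 a2 (nm_nonneg _) hC
    have t2 := mul_le_mul a1 b2 (wt_nonneg _) (by positivity)
    refine (add_le_add t1 t2).trans (le_of_eq (by ring))
  · have a1 := h₁.nm_le hC j (j + m) N hN0 (hr _ _ (by omega))
    have a2 := h₂.nm_le hC (j + m) (j + 2 * m) N hN0 (hr _ _ (by omega))
    have a3 := h₃.nm_le hC (j + 2 * m) (j + 3 * m) N hN0 (hr _ _ (by omega))
    have := nm_mul_le (nm_mul_le (nm_mul_le a1 a2) a3) (nm_Prd hp (j + 3 * m) n).le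
    rw [e]
    convert this using 1
    · congr 1; ring
    · rw [show N * √N = √N * √N * √N by rw [hs]]; field_simp; ring
  · have a1 := h₁.nm_le hC j (j + m) N hN0 (hr _ _ (by omega))
    have a2 := h₂.nm_le hC (j + m) (j + 2 * m) N hN0 (hr _ _ (by omega))
    have a3 := h₃.nm_le hC (j + 2 * m) (j + 3 * m) N hN0 (hr _ _ (by omega))
    have a4 := h₄.nm_le hC (j + 3 * m) n N hN0 (hr _ _ (by omega))
    have := nm_mul_le (nm_mul_le (nm_mul_le a1 a2) a3) a4
    rw [e]
    convert this using 1
    · congr 1; ring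
    · rw [show N ^ 2 = √N * √N * (√N * √N) by rw [hs]; ring]; field_simp; ring

lemma stp_sub_one {d d₁ : ℕ} (l : Fin d₁ → Fin d → ℤ) (c : Fin d₁ → ℝ) :
    stp l c - 1 = ∑ k, (- c k) • ((tau (l k) - 1) * (tau (-l k) - 1)) := by
  rw [stp, add_sub_cancel_left]
  refine Finset.sum_congr rfl fun k _ => ?_
  have := tau_neg_mul (l k)
  rw [neg_smul, ← smul_neg]
  congr 1
  linear_combination this

structure KerEst {d : ℕ} (C : ℝ) (κ : ℤ → ℤ → RR d) : Prop where
  zero : ∀ j n, n ≤ j → κ j n = 0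
  sp : ∀ j n, j < n → ∀ v, nm ((tau v - 1) * κ j n) ≤
    C / (((n - j : ℤ) : ℝ) * √((n - j : ℤ) : ℝ)) * l1 v
  mom : ∀ j n, j < n → wt (κ j n) ≤ C / √((n - j : ℤ) : ℝ)
  tm : ∀ j n, j < n → nm (κ (j - 1) n - κ j n) ≤ C / ((n - j : ℤ) : ℝ) ^ 2
  tm' : ∀ j n, j < n → nm (κ j (n + 1) - κ j n) ≤ C / ((n - j : ℤ) : ℝ) ^ 2

def Dd {d : ℕ} (i : Fin d) : RR d := tau (-stdE d i) - 1

def kap {d d₁ : ℕ} (l : Fin d₁ → Fin d → ℤ) (c : ℤ → Fin d₁ → ℝ) (p q : Fin d) (j n : ℤ) : RR d :=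
  if j < n then Dd p * Dd q * Prd l c j n else 0

lemma kerEst {d d₁ : ℕ} (hdd₁ : d ≤ d₁) (l : Fin d₁ → Fin d → ℤ)
    (hl : ∀ (k : Fin d₁) (hk : (k : ℕ) < d), l k = stdE d ⟨k, hk⟩)
    (a b : ℝ) (ha : 0 < a) (hab : a ≤ b)
    (hb : 2 * d₁ * b < 1) : ∃ C : ℝ, 0 < C ∧ ∀ c : ℤ → Fin d₁ → ℝ, WB a b c → ∀ p q,
      KerEst C (kap l c p q) := by
  obtain ⟨C, hC, H⟩ := goodX_exists l a b ha hab hb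
  have hb0 : 0 ≤ b := ha.le.trans hab
  have hle : ∀ i : Fin d, l ⟨i, i.2.trans_le hdd₁⟩ = stdE d i := fun i => hl _ i.2
  set K : ℝ := 4 * C ^ 2 + 8 * C ^ 3 + d₁ * b * (16 * C ^ 4) with hK
  refine ⟨K, by positivity, fun c hc p q => ?_⟩
  have hp : ∀ i, Posi (stp l (c i)) := fun i => stp_pos l _ (fun k => ha.le.trans (hc i k).1) (by
    have := hc.sum_le i
    linarith)
  have gD : ∀ i, GoodX l c C (Dd i) := fun i => by
    have := (H c hc ⟨i, i.2.trans_le hdd₁⟩).2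
    rwa [hle] at this
  have gE : ∀ i, GoodX l c C (tau (stdE d i) - 1) := fun i => by
    have := (H c hc ⟨i, i.2.trans_le hdd₁⟩).1
    rwa [hle] at this
  have htime : ∀ i j n : ℤ, j < n → nm ((stp l (c i) - 1) * (Dd p * Dd q * Prd l c j n)) ≤
      K / ((n - j : ℤ) : ℝ) ^ 2 := fun i j n hjn => by
    rw [stp_sub_one, Finset.sum_mul]
    refine (wn_sum (fun _ => zero_le_one) _ _).trans ?_
    have h1 : ∀ k ∈ (Finset.univ : Finset (Fin d₁)), wn (fun _ => 1)
        ((-c i k) • ((tau (l k) - 1) * (tau (-l k) - 1)) * (Dd p * Dd q * Prd l c j n)) ≤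
        b * (16 * C ^ 4 / ((n - j : ℤ) : ℝ) ^ 2) := fun k _ => by
      rw [smul_mul_assoc, wn_smul, abs_neg, abs_of_nonneg (ha.le.trans (hc i k).1)]
      have := ((good_est hp hC.le j n hjn _ rfl (gD p) (gD q)).2 _ (H c hc k).1).2 _ (H c hc k).2
      refine mul_le_mul (hc i k).2 ?_ (nm_nonneg _) hb0
      refine le_trans (le_of_eq ?_) this
      change nm _ = nm _
      congr 1; ring
    refine (Finset.sum_le_sum h1).trans ?_
    rw [Finset.sum_const, Finset.card_univ, Fintype.card_fin, nsmul_eq_mul, ← mul_assoc, ← mul_div_assoc]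
    apply div_le_div_of_nonneg_right _ (by positivity)
    rw [hK]; nlinarith [pow_pos hC 2, pow_pos hC 3]
  constructor
  · intro j n h; rw [kap, if_neg (by omega)]
  · intro j n h v
    apply nm_tau_path
    intro i
    rw [kap, if_pos h]
    have := ((good_est hp hC.le j n h _ rfl (gD p) (gD q)).2 _ (gE i)).1
    rw [show (tau (stdE d i) - 1) * (Dd p * Dd q * Prd l c j n) =
      Dd p * Dd q * (tau (stdE d i) - 1) * Prd l c j n by ring]
    refine this.trans (div_le_div_of_nonneg_right ?_ (by
      have : (0 : ℝ) ≤ ((n - j : ℤ) : ℝ) := by exact_mod_cast (by omega : 0 ≤ n - j)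
      positivity))
    rw [hK]; have : 0 ≤ d₁ * b * (16 * C ^ 4) := by positivity
    nlinarith [pow_pos hC 2, pow_pos hC 3]
  · intro j n h
    rw [kap, if_pos h]
    refine (good_est hp hC.le j n h _ rfl (gD p) (gD q)).1.trans
      (div_le_div_of_nonneg_right ?_ (Real.sqrt_nonneg _))
    rw [hK]; have : 0 ≤ d₁ * b * (16 * C ^ 4) := by positivity
    nlinarith [pow_pos hC 2, pow_pos hC 3]
  · intro j n h
    rw [kap, kap, if_pos h, if_pos (by omega), Prd_split l c (show j - 1 ≤ j by omega) h.le]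
    refine le_trans (le_of_eq ?_) (htime (j - 1) j n h)
    congr 1
    have : Prd l c (j - 1) j = stp l (c (j - 1)) := by
      rw [Prd, show Finset.Ico (j - 1) j = {j - 1} by ext; simp; omega]; simp
    rw [this]; ring
  · intro j n h
    rw [kap, kap, if_pos h, if_pos (by omega), Prd_split l c h.le (show n ≤ n + 1 by omega)]
    refine le_trans (le_of_eq ?_) (htime n j n h)
    congr 1
    have : Prd l c n (n + 1) = stp l (c n) := by
      rw [Prd, show Finset.Ico n (n + 1) = {n} by ext; simp; omega]; simp
    rw [this]; ring

def cj {d : ℕ} : RR d ≃ₐ[ℝ] RR d := AddMonoidAlgebra.domCongr ℝ ℝ (AddEquiv.neg (Fin d → ℤ))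

@[simp] lemma cj_tau {d : ℕ} (x : Fin d → ℤ) : cj (tau x) = tau (-x) := by
  simp [cj, tau]

lemma prg_cj {d : ℕ} (φ : (Fin d → ℤ) → ℝ) (u : RR d) : prg φ (cj u) = prg (fun x => φ (-x)) u := by
  induction u using AddMonoidAlgebra.induction_linear with
  | zero => simp
  | add a b ha hb => simp [ha, hb]
  | single x c => simp [cj]

lemma cj_cj {d : ℕ} (u : RR d) : cj (cj u) = u := by
  induction u using AddMonoidAlgebra.induction_linear with
  | zero => simp
  | add a b ha hb => simp [ha, hb]
  | single x c => simp [cj]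

def tr {d : ℕ} : RR d →ₗ[ℝ] ℝ := prg (fun x => if x = 0 then 1 else 0)

lemma tr_cj {d : ℕ} (u : RR d) : tr (cj u) = tr u := by
  rw [tr, prg_cj]; simp

lemma prg_ind {d : ℕ} (x : Fin d → ℤ) (u : RR d) :
    prg (fun y => if y = x then 1 else 0) u = u.coeff x := by
  simp only [prg_def, Finsupp.sum, mul_ite, mul_one, mul_zero, Finset.sum_ite_eq']
  split_ifs with h
  · rfl
  · simp at h; simp [h]

def sqn {d : ℕ} (u : RR d) : ℝ := tr (u * cj u)

lemma sqn_eq {d : ℕ} (u : RR d) : sqn u = u.coeff.sum fun _ c => c ^ 2 := by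
  rw [sqn, tr, prg_mul]
  have : ∀ x, prg (fun y => if x + y = 0 then (1 : ℝ) else 0) (cj u) = u.coeff x := fun x => by
    rw [prg_cj, ← prg_ind]
    congr 2; ext y
    simp only [← sub_eq_add_neg, sub_eq_zero, eq_comm]
  simp only [this, prg_def, Finsupp.sum, sq]

lemma sqn_nonneg {d : ℕ} (u : RR d) : 0 ≤ sqn u := by
  rw [sqn_eq]; exact Finset.sum_nonneg fun _ _ => sq_nonneg _

def NNg {d : ℕ} (z : RR d) : Prop := ∀ u, 0 ≤ tr (z * (u * cj u))

lemma NNg.add {d : ℕ} {y z : RR d} (hy : NNg y) (hz : NNg z) : NNg (y + z) := fun u => by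
  rw [add_mul, map_add]; exact add_nonneg (hy u) (hz u)
lemma NNg.sum {d : ℕ} {ι : Type*} (s : Finset ι) (z : ι → RR d) (h : ∀ i ∈ s, NNg (z i)) :
    NNg (∑ i ∈ s, z i) := fun u => by
  rw [Finset.sum_mul, map_sum]; exact Finset.sum_nonneg fun i hi => h i hi u
lemma NNg.smul {d : ℕ} {z : RR d} {c : ℝ} (hc : 0 ≤ c) (hz : NNg z) : NNg (c • z) := fun u => by
  rw [smul_mul_assoc, map_smul]; exact mul_nonneg hc (hz u)
lemma NNg.mulsq {d : ℕ} {z : RR d} (hz : NNg z) (v : RR d) : NNg (z * (v * cj v)) := fun u => by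
  have := hz (v * u)
  have e : cj (v * u) = cj v * cj u := map_mul cj v u
  rw [e] at this
  convert this using 2; ring
lemma NNg.one {d : ℕ} : NNg (1 : RR d) := fun u => by rw [one_mul]; exact sqn_nonneg u
lemma NNg.zero {d : ℕ} : NNg (0 : RR d) := fun u => by simp
lemma NNg.sq {d : ℕ} (v : RR d) : NNg (v * cj v) := by
  have := NNg.one.mulsq v; rwa [one_mul] at this

def Ee {d : ℕ} (x : Fin d → ℤ) : RR d := 2 - tau x - tau (-x)
def Ff {d : ℕ} (x : Fin d → ℤ) : RR d := 2 + tau x + tau (-x)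

lemma Ee_eq {d : ℕ} (x : Fin d → ℤ) : Ee x = (tau x - 1) * cj (tau x - 1) := by
  simp only [Ee, map_sub, map_one, cj_tau]
  linear_combination -(tau_neg_mul x)
lemma Ee_eq' {d : ℕ} (x : Fin d → ℤ) : Ee x = (tau (-x) - 1) * cj (tau (-x) - 1) := by
  simp only [Ee, map_sub, map_one, cj_tau, neg_neg]
  linear_combination -(tau_neg_mul x)
lemma Ff_eq {d : ℕ} (x : Fin d → ℤ) : Ff x = (tau x + 1) * cj (tau x + 1) := by
  simp only [Ff, map_add, map_one, cj_tau]
  linear_combination -(tau_neg_mul x)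
lemma NNg.mulE {d : ℕ} {z : RR d} (hz : NNg z) (x : Fin d → ℤ) : NNg (z * Ee x) := by
  rw [Ee_eq]; exact hz.mulsq _
lemma NNg.mulF {d : ℕ} {z : RR d} (hz : NNg z) (x : Fin d → ℤ) : NNg (z * Ff x) := by
  rw [Ff_eq]; exact hz.mulsq _
lemma NNg.E {d : ℕ} (x : Fin d → ℤ) : NNg (Ee x) := by rw [Ee_eq]; exact NNg.sq _
lemma NNg.F {d : ℕ} (x : Fin d → ℤ) : NNg (Ff x) := by rw [Ff_eq]; exact NNg.sq _

def Lap {d d₁ : ℕ} (l : Fin d₁ → Fin d → ℤ) : RR d := ∑ k, Ee (l k)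

lemma cj_E {d : ℕ} (x : Fin d → ℤ) : cj (Ee x) = Ee x := by
  simp only [Ee, map_sub, cj_tau, neg_neg, map_ofNat]; ring
lemma cj_Lap {d d₁ : ℕ} (l : Fin d₁ → Fin d → ℤ) : cj (Lap l) = Lap l := by
  simp [Lap, cj_E]
lemma stp_E {d d₁ : ℕ} (l : Fin d₁ → Fin d → ℤ) (c : Fin d₁ → ℝ) :
    stp l c = 1 - ∑ k, c k • Ee (l k) := by
  rw [stp, sub_eq_add_neg, ← Finset.sum_neg_distrib]
  congr 1
  refine Finset.sum_congr rfl fun k _ => ?_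
  rw [← smul_neg, Ee]; congr 1; ring
lemma stp_F {d d₁ : ℕ} (l : Fin d₁ → Fin d → ℤ) (c : Fin d₁ → ℝ) :
    1 + stp l c = (2 * (1 - 2 * ∑ k, c k)) • 1 + ∑ k, c k • Ff (l k) := by
  rw [stp_eq]
  have : ∀ k, c k • Ff (l k) = c k • (tau (l k) + tau (-l k)) + (2 * c k) • 1 := fun k => by
    simp only [Ff, Algebra.smul_def, map_mul, map_ofNat]; ring
  simp only [this, Finset.sum_add_distrib, ← Finset.sum_smul, ← Finset.mul_sum]
  simp only [Algebra.smul_def, map_mul, map_sub, map_one, map_ofNat]; ring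
lemma cj_stp {d d₁ : ℕ} (l : Fin d₁ → Fin d → ℤ) (c : Fin d₁ → ℝ) : cj (stp l c) = stp l c := by
  simp [stp_E, cj_E]

lemma NNg.mulLap {d d₁ : ℕ} {z : RR d} (hz : NNg z) (l : Fin d₁ → Fin d → ℤ) : NNg (z * Lap l) := by
  rw [Lap, Finset.mul_sum]; exact NNg.sum _ _ fun k _ => hz.mulE _

lemma key_NN {d d₁ : ℕ} (l : Fin d₁ → Fin d → ℤ) (c : Fin d₁ → ℝ) (a c₀ : ℝ) (ha : 0 ≤ a)
    (hc : ∀ k, a ≤ c k) (hs : 0 ≤ 1 - 2 * ∑ k, c k) (hc₀ : c₀ ≤ 2 * (1 - 2 * ∑ k, c k) * a) :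
    NNg ((1 - stp l c) * (1 + stp l c) - c₀ • Lap l) := by
  have h1 : (1 - stp l c) = ∑ k, c k • Ee (l k) := by rw [stp_E]; ring
  have : (1 - stp l c) * (1 + stp l c) - c₀ • Lap l =
      ∑ k, (2 * (1 - 2 * ∑ k, c k) * c k - c₀) • Ee (l k) +
      ∑ k, ∑ j, (c k * c j) • (Ee (l k) * Ff (l j)) := by
    rw [stp_F, h1, mul_add, Finset.sum_mul_sum]
    simp only [sub_smul, Finset.sum_sub_distrib, Lap, ← Finset.smul_sum, smul_mul_smul_comm]
    rw [mul_smul_one, Finset.smul_sum]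
    simp only [smul_smul]
    ring
  rw [this]
  refine (NNg.sum _ _ fun k _ => (NNg.E _).smul ?_).add (NNg.sum _ _ fun k _ => NNg.sum _ _ fun j _ =>
    ((NNg.E _).mulF _).smul (mul_nonneg (ha.trans (hc k)) (ha.trans (hc j))))
  have := mul_le_mul_of_nonneg_left (hc k) (show 0 ≤ 2 * (1 - 2 * ∑ k, c k) by linarith)
  linarith

lemma sqn_add_le {d : ℕ} (u v : RR d) : sqn (u + v) ≤ 2 * sqn u + 2 * sqn v := by
  have := sqn_nonneg (u - v)
  have e : sqn (u + v) + sqn (u - v) = 2 * sqn u + 2 * sqn v := by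
    simp only [sqn, map_add, map_sub, mul_add, add_mul, mul_sub, sub_mul]; ring
  linarith
lemma sqn_sub_le {d : ℕ} (u v : RR d) : sqn (u - v) ≤ 2 * sqn u + 2 * sqn v := by
  have := sqn_nonneg (u + v)
  have e : sqn (u + v) + sqn (u - v) = 2 * sqn u + 2 * sqn v := by
    simp only [sqn, map_add, map_sub, mul_add, add_mul, mul_sub, sub_mul]; ring
  linarith

lemma cross_le {d : ℕ} (x f : RR d) (c₀ : ℝ) (hc₀ : 0 < c₀) :
    2 * tr (x * cj f) ≤ c₀ / 2 * sqn x + 2 / c₀ * sqn f := by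
  have h := sqn_nonneg ((c₀ / 2) • x - f)
  have e1 : tr (f * cj x) = tr (x * cj f) := by
    rw [← tr_cj (x * cj f), map_mul cj, cj_cj, mul_comm]
  have e : sqn ((c₀ / 2) • x - f) = (c₀ / 2) ^ 2 * sqn x - c₀ * tr (x * cj f) + sqn f := by
    simp only [sqn, map_sub, mul_sub, sub_mul, map_smul, smul_mul_assoc, mul_smul_comm, smul_eq_mul, e1]
    ring
  rw [e] at h
  have h2 : 0 ≤ (2 / c₀) * ((c₀ / 2) ^ 2 * sqn x - c₀ * tr (x * cj f) + sqn f) := by positivity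
  have e2 : (2 / c₀) * ((c₀ / 2) ^ 2 * sqn x - c₀ * tr (x * cj f) + sqn f) =
    c₀ / 2 * sqn x + 2 / c₀ * sqn f - 2 * tr (x * cj f) := by
    field_simp
    ring
  linarith

def En {d d₁ : ℕ} (l : Fin d₁ → Fin d → ℤ) (w : RR d) : ℝ := tr (Lap l * (w * cj w))

lemma En_step {d d₁ : ℕ} (l : Fin d₁ → Fin d → ℤ) (c : Fin d₁ → ℝ) (a c₀ : ℝ) (ha : 0 ≤ a)
    (hc : ∀ k, a ≤ c k) (hs : 0 ≤ 1 - 2 * ∑ k, c k) (hc₀0 : 0 < c₀)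
    (hc₀ : c₀ ≤ 2 * (1 - 2 * ∑ k, c k) * a) (w f : RR d) :
    En l (stp l c * w + f) + c₀ / 2 * sqn (Lap l * w) ≤ En l w + (2 / c₀ + 4 * d₁) * sqn f := by
  set s := stp l c
  set L := Lap l
  have k1 := key_NN l c a c₀ ha hc hs hc₀
  have k2 := key_NN l c a 0 ha hc hs (hc₀0.le.trans hc₀)
  have h1 : 0 ≤ En l w - tr (L * (s * s) * (w * cj w)) - c₀ * sqn (L * w) := by
    have := k1.mulLap l w
    have e : ((1 - s) * (1 + s) - c₀ • L) * L * (w * cj w) = L * (w * cj w)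
        - L * (s * s) * (w * cj w) - c₀ • ((L * w) * cj (L * w)) := by
      rw [map_mul, cj_Lap, Algebra.smul_def, Algebra.smul_def]; ring
    have e' : tr (((1 - s) * (1 + s) - c₀ • L) * L * (w * cj w)) =
      En l w - tr (L * (s * s) * (w * cj w)) - c₀ * sqn (L * w) := by
      rw [e, map_sub, map_sub, map_smul]; rfl
    rw [← e']; exact this
  have h2 : sqn (L * s * w) ≤ sqn (L * w) := by
    have := (k2.mulsq L) w
    have e : ((1 - s) * (1 + s) - (0 : ℝ) • L) * (L * cj L) * (w * cj w) =
        (L * w) * cj (L * w) - (L * s * w) * cj (L * s * w) := by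
      rw [map_mul, map_mul, map_mul, cj_stp, zero_smul]; ring
    have e' : tr (((1 - s) * (1 + s) - (0 : ℝ) • L) * (L * cj L) * (w * cj w)) =
        sqn (L * w) - sqn (L * s * w) := by rw [e, map_sub]; rfl
    have t : 0 ≤ sqn (L * w) - sqn (L * s * w) := by rw [← e']; exact this
    linarith
  have h3 : tr (L * (f * cj f)) ≤ 4 * d₁ * sqn f := by
    have : NNg (∑ k, Ff (l k)) := NNg.sum _ _ fun k _ => NNg.F _
    have h := this f
    have e : ∑ k, Ff (l k) = (4 * d₁ : ℝ) • 1 - L := by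
      have : ∀ k, Ff (l k) = (4 : ℝ) • 1 - Ee (l k) := fun k => by
        simp only [Ff, Ee, Algebra.smul_def, map_ofNat]; ring
      simp only [this, Finset.sum_sub_distrib, L, Lap, Finset.sum_const, Finset.card_univ, Fintype.card_fin]
      rw [← Nat.cast_smul_eq_nsmul ℝ, smul_smul]; congr 2; ring
    rw [e, sub_mul, map_sub, smul_mul_assoc, one_mul, map_smul, smul_eq_mul] at h
    change 0 ≤ 4 * (d₁ : ℝ) * sqn f - _ at h
    linarith
  have h4 := cross_le (L * s * w) f c₀ hc₀0
  have e : En l (s * w + f) = tr (L * (s * s) * (w * cj w)) + 2 * tr (L * s * w * cj f)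
      + tr (L * (f * cj f)) := by
    have e1 : tr (L * f * (s * cj w)) = tr (L * s * w * cj f) := by
      rw [← tr_cj (L * s * w * cj f), map_mul cj, map_mul cj, map_mul cj, cj_cj, cj_Lap, cj_stp]; congr 1; ring
    have : L * ((s * w + f) * cj (s * w + f)) = L * (s * s) * (w * cj w) + L * s * w * cj f
      + L * f * (s * cj w) + L * (f * cj f) := by
      rw [map_add, map_mul, cj_stp]; ring
    rw [En, this, map_add, map_add, map_add, e1]; ring
  have : c₀ / 2 * sqn (L * s * w) ≤ c₀ / 2 * sqn (L * w) :=
    mul_le_mul_of_nonneg_left h2 (by positivity)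
  rw [e]; linarith

lemma sqn_DD {d d₁ : ℕ} (hdd₁ : d ≤ d₁) (l : Fin d₁ → Fin d → ℤ)
    (hl : ∀ (k : Fin d₁) (hk : (k : ℕ) < d), l k = stdE d ⟨k, hk⟩) (p q : Fin d) (w : RR d) :
    sqn (Dd p * Dd q * w) ≤ sqn (Lap l * w) := by
  have hle : ∀ i : Fin d, Ee (stdE d i) = Ee (l ⟨i, i.2.trans_le hdd₁⟩) := fun i => by
    rw [hl _ i.2]
  have hs : ∀ k, ∃ r, Lap l = Ee (l k) + r ∧ ∀ z, NNg z → NNg (z * r) := fun k => by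
    refine ⟨∑ j ∈ Finset.univ.erase k, Ee (l j), (Finset.add_sum_erase _ _ (Finset.mem_univ k)).symm,
      fun z hz => ?_⟩
    rw [Finset.mul_sum]; exact NNg.sum _ _ fun k _ => hz.mulE _
  obtain ⟨r, hr, hr'⟩ := hs ⟨p, p.2.trans_le hdd₁⟩
  obtain ⟨t, ht, ht'⟩ := hs ⟨q, q.2.trans_le hdd₁⟩
  have h1 : NNg (Ee (l ⟨p, p.2.trans_le hdd₁⟩) * t) := ht' _ (NNg.E _)
  have h2 : NNg (Lap l * r) := hr' _ (by have := NNg.one.mulLap l; rwa [one_mul] at this)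
  have h3 := (h1.add h2) w
  have e : (Ee (l ⟨p, p.2.trans_le hdd₁⟩) * t + Lap l * r) * (w * cj w) =
      (Lap l * w) * cj (Lap l * w) - (Dd p * Dd q * w) * cj (Dd p * Dd q * w) := by
    have e1 : Dd p * cj (Dd p) = Ee (l ⟨p, p.2.trans_le hdd₁⟩) := by rw [← hle, Ee_eq']; rfl
    have e2 : Dd q * cj (Dd q) = Ee (l ⟨q, q.2.trans_le hdd₁⟩) := by rw [← hle, Ee_eq']; rfl
    have e3 : (Dd p * Dd q * w) * cj (Dd p * Dd q * w) =
      (Dd p * cj (Dd p)) * (Dd q * cj (Dd q)) * (w * cj w) := by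
      simp only [map_mul]; ring
    rw [e3, e1, e2, map_mul, cj_Lap]
    have e4 : Ee (l ⟨q, q.2.trans_le hdd₁⟩) = Lap l - t := by rw [ht]; ring
    have e5 : Ee (l ⟨p, p.2.trans_le hdd₁⟩) = Lap l - r := by rw [hr]; ring
    rw [e4, e5]; ring
  rw [e, map_sub] at h3
  change 0 ≤ sqn _ - sqn _ at h3
  linarith

lemma sqn_DD' {d : ℕ} (p q : Fin d) (w : RR d) : sqn (Dd p * Dd q * w) ≤ 16 * sqn w := by
  have h : ∀ (p : Fin d) (w : RR d), sqn (Dd p * w) ≤ 4 * sqn w := fun p w => by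
    have h1 := NNg.F (stdE d p) w
    have e : Ff (stdE d p) * (w * cj w) = (4 : ℝ) • (w * cj w) - (Dd p * w) * cj (Dd p * w) := by
      have e1 : Dd p * cj (Dd p) = Ee (stdE d p) := by rw [Ee_eq']; rfl
      have e2 : (Dd p * w) * cj (Dd p * w) = (Dd p * cj (Dd p)) * (w * cj w) := by
        simp only [map_mul]; ring
      rw [e2, e1, Ff, Ee, Algebra.smul_def, map_ofNat]; ring
    rw [e, map_sub, map_smul] at h1
    change 0 ≤ 4 * sqn _ - sqn _ at h1
    linarith
  rw [mul_assoc]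
  linarith [h p (Dd q * w), h q w]

lemma L2_est {d d₁ : ℕ} (hdd₁ : d ≤ d₁) (l : Fin d₁ → Fin d → ℤ)
    (hl : ∀ (k : Fin d₁) (hk : (k : ℕ) < d), l k = stdE d ⟨k, hk⟩)
    (a b : ℝ) (ha : 0 < a) (hab : a ≤ b)
    (hb : 2 * d₁ * b < 1) : ∃ C : ℝ, 0 < C ∧ ∀ c : ℤ → Fin d₁ → ℝ, WB a b c → ∀ p q,
      ∀ (J W : Finset ℤ) (f : ℤ → RR d),
        ∑ n ∈ W, sqn (∑ j ∈ J, kap l c p q j n * f j) ≤ C * ∑ j ∈ J, sqn (f j) := by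
  set c₀ : ℝ := 2 * (1 - 2 * (d₁ * b)) * a with hc₀
  have hc₀0 : 0 < c₀ := by
    have : 0 < 1 - 2 * (d₁ * b) := by linarith
    positivity
  set K : ℝ := 2 / c₀ + 4 * d₁ with hK
  have hK0 : 0 < K := by positivity
  refine ⟨4 / c₀ * K + 32, by positivity, fun c hc p q J W f' => ?_⟩
  -- reduce to functions vanishing off J
  obtain ⟨f, hf, hff⟩ : ∃ f : ℤ → RR d, (∀ j ∉ J, f j = 0) ∧ ∀ j ∈ J, f j = f' j :=
    ⟨fun j => if j ∈ J then f' j else 0, fun j hj => if_neg hj, fun j hj => if_pos hj⟩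
  have hJ : ∑ j ∈ J, sqn (f' j) = ∑ j ∈ J, sqn (f j) :=
    Finset.sum_congr rfl fun j hj => by rw [hff j hj]
  have hWW : ∀ n, ∑ j ∈ J, kap l c p q j n * f' j = ∑ j ∈ J, kap l c p q j n * f j :=
    fun n => Finset.sum_congr rfl fun j hj => by rw [hff j hj]
  rw [hJ]
  simp only [hWW]
  set w : ℤ → RR d := fun n => ∑ j ∈ J, if j ≤ n then Prd l c j n * f j else 0 with hw
  have hPn : ∀ n, Prd l c n n = 1 := fun n => by simp [Prd]
  have hrec : ∀ n, w (n + 1) = stp l (c n) * w n + f (n + 1) := fun n => by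
    have : f (n + 1) = ∑ j ∈ J, if j = n + 1 then f j else 0 := by
      rw [Finset.sum_ite_eq']
      split_ifs with h
      · rfl
      · exact hf _ h
    rw [this]
    simp only [hw]
    rw [Finset.mul_sum, ← Finset.sum_add_distrib]
    refine Finset.sum_congr rfl fun j _ => ?_
    rcases lt_trichotomy j (n + 1) with h | h | h
    · rw [if_pos h.le, if_pos (by omega), if_neg h.ne, Prd_split l c (show j ≤ n by omega)
        (show n ≤ n + 1 by omega), add_zero]
      have : Prd l c n (n + 1) = stp l (c n) := by
        rw [Prd, show Finset.Ico n (n + 1) = {n} by ext; simp; omega]; simp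
      rw [this]; ring
    · subst h
      rw [if_pos le_rfl, if_neg (by omega), if_pos rfl, hPn]; simp
    · rw [if_neg (by omega), if_neg (by omega), if_neg (by omega)]; simp
  have hout : ∀ n, ∑ j ∈ J, kap l c p q j n * f j = Dd p * Dd q * w n - Dd p * Dd q * f n := fun n => by
    have : f n = ∑ j ∈ J, if j = n then f j else 0 := by
      rw [Finset.sum_ite_eq']
      split_ifs with h
      · rfl
      · exact hf _ h
    rw [this]
    simp only [hw]
    rw [Finset.mul_sum, Finset.mul_sum, ← Finset.sum_sub_distrib]
    refine Finset.sum_congr rfl fun j _ => ?_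
    rw [kap]
    rcases lt_trichotomy j n with h | h | h
    · rw [if_pos h, if_pos h.le, if_neg h.ne]; ring
    · subst h
      rw [if_neg (lt_irrefl _), if_pos le_rfl, if_pos rfl, hPn]; ring
    · rw [if_neg (by omega), if_neg (by omega), if_neg (by omega)]; ring
  obtain ⟨n₀, hn₀⟩ : ∃ n₀ : ℤ, ∀ n ∈ J ∪ W, n₀ < n := by
    obtain ⟨m, hm⟩ := (J ∪ W).bddBelow
    exact ⟨m - 1, fun n hn => by have := hm hn; omega⟩
  obtain ⟨n₁, hn₁⟩ : ∃ n₁ : ℕ, ∀ n ∈ J ∪ W, n < n₀ + n₁ := by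
    obtain ⟨m, hm⟩ := (J ∪ W).bddAbove
    exact ⟨(m + 1 - n₀).toNat, fun n hn => by have := hm hn; omega⟩
  have hw0 : w n₀ = 0 := by
    simp only [hw]
    refine Finset.sum_eq_zero fun j hj => if_neg ?_
    have := hn₀ j (Finset.mem_union_left _ hj); omega
  have hind : ∀ M : ℕ, En l (w (n₀ + M)) + c₀ / 2 * ∑ i ∈ Finset.range M, sqn (Lap l * w (n₀ + i)) ≤
      K * ∑ i ∈ Finset.range M, sqn (f (n₀ + i + 1)) := fun M => by
    induction M with
    | zero => simp [hw0, En]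
    | succ M ih =>
      rw [Finset.sum_range_succ, Finset.sum_range_succ]
      have hsum := hc.sum_le (n₀ + M)
      have hb' : 0 ≤ 1 - 2 * (d₁ * b) := by linarith
      have := En_step l (c (n₀ + M)) a c₀ ha.le (fun k => (hc _ k).1) (by linarith) hc₀0 (by
        rw [hc₀]; exact mul_le_mul_of_nonneg_right (by linarith) ha.le) (w (n₀ + M)) (f (n₀ + M + 1))
      rw [← hrec] at this
      push_cast
      rw [← add_assoc]
      linarith
  have hEn : 0 ≤ En l (w (n₀ + n₁)) := by
    have := NNg.one.mulLap l (w (n₀ + n₁)); rwa [one_mul] at this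
  have hfJ : ∀ g : ℤ → ℤ, Function.Injective g → ∀ s : Finset ℕ,
      ∑ i ∈ s, sqn (f (g i)) ≤ ∑ j ∈ J, sqn (f j) := fun g hg s => by
    rw [← Finset.sum_image (g := fun i : ℕ => g i) (f := fun j => sqn (f j))
      (fun x _ y _ h => by exact_mod_cast hg h)]
    refine (Finset.sum_le_sum_of_subset_of_nonneg (Finset.subset_union_left (s₂ := J))
      fun _ _ _ => sqn_nonneg _).trans (le_of_eq ?_)
    refine (Finset.sum_subset Finset.subset_union_right fun j _ hj => ?_).symm
    rw [hf j hj]; simp [sqn]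
  have hL : ∑ i ∈ Finset.range n₁, sqn (Lap l * w (n₀ + i)) ≤ 2 / c₀ * (K * ∑ j ∈ J, sqn (f j)) := by
    have h1 := hind n₁
    have h2 := mul_le_mul_of_nonneg_left (hfJ (fun i => n₀ + i + 1) (fun x y h => by simpa using h)
      (Finset.range n₁)) hK0.le
    have h3 : c₀ / 2 * ∑ i ∈ Finset.range n₁, sqn (Lap l * w (n₀ + i)) ≤ K * ∑ j ∈ J, sqn (f j) := by
      linarith
    have := mul_le_mul_of_nonneg_left h3 (show 0 ≤ 2 / c₀ by positivity)
    refine le_trans (le_of_eq ?_) this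
    field_simp
  have hWs : ∀ g : ℤ → ℝ, (∀ n, 0 ≤ g n) → ∑ n ∈ W, g n ≤ ∑ i ∈ Finset.range n₁, g (n₀ + i) := fun g hg => by
    rw [← Finset.sum_image (g := fun i : ℕ => n₀ + (i : ℤ)) (f := g)
      (fun x _ y _ h => by simpa using h)]
    refine Finset.sum_le_sum_of_subset_of_nonneg (fun n hn => ?_) fun _ _ _ => hg _
    have h1 := hn₀ n (Finset.mem_union_right _ hn)
    have h2 := hn₁ n (Finset.mem_union_right _ hn)
    simp only [Finset.mem_image, Finset.mem_range]
    exact ⟨(n - n₀).toNat, by omega, by omega⟩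
  refine (hWs _ fun _ => sqn_nonneg _).trans ?_
  have h5 : ∀ n, sqn (∑ j ∈ J, kap l c p q j n * f j) ≤ 2 * sqn (Lap l * w n) + 32 * sqn (f n) := fun n => by
    rw [hout]
    refine (sqn_sub_le _ _).trans ?_
    linarith [sqn_DD hdd₁ l hl p q (w n), sqn_DD' p q (f n)]
  refine (Finset.sum_le_sum fun i _ => h5 _).trans ?_
  rw [Finset.sum_add_distrib, ← Finset.mul_sum, ← Finset.mul_sum]
  have h6 := hfJ (fun i => n₀ + i) (fun x y h => by simpa using h) (Finset.range n₁)
  have e : (4 / c₀ * K + 32) * ∑ j ∈ J, sqn (f j) = 2 * (2 / c₀ * (K * ∑ j ∈ J, sqn (f j)))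
      + 32 * ∑ j ∈ J, sqn (f j) := by ring
  rw [e]; linarith

structure Dy (X : Type) [DecidableEq X] where
  Q : ℕ → X → X
  cell : ℕ → X → Finset X
  star : ℕ → X → Finset X
  B : ℝ
  A : ℝ
  hB : 1 < B
  hA : 0 ≤ A
  Q0 : ∀ z, Q 0 z = z
  Qs : ∀ k z z', Q k z = Q k z' → Q (k + 1) z = Q (k + 1) z'
  mem : ∀ k c z, z ∈ cell k c ↔ Q k z = c
  card : ∀ k z, ((cell k (Q k z)).card : ℝ) = B ^ k
  starc : ∀ k c, ((star k c).card : ℝ) ≤ A * B ^ k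

structure Prt {X : Type} (Ω : Finset X) (cl : X → Finset X) : Prop where
  sub : ∀ z ∈ Ω, cl z ⊆ Ω
  eq : ∀ z ∈ Ω, ∀ z' ∈ cl z, cl z' = cl z
  self : ∀ z ∈ Ω, z ∈ cl z

lemma Prt.swap {X : Type} [DecidableEq X] {Ω : Finset X} {cl : X → Finset X} (h : Prt Ω cl) (F : X → X → ℝ) :
    ∑ z ∈ Ω, ((cl z).card : ℝ)⁻¹ * ∑ z' ∈ cl z, F z z' =
    ∑ z' ∈ Ω, ((cl z').card : ℝ)⁻¹ * ∑ z ∈ cl z', F z z' := by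
  simp only [Finset.mul_sum]
  have : ∀ z ∈ Ω, ∀ z' ∈ cl z, ((cl z).card : ℝ)⁻¹ * F z z' = ((cl z').card : ℝ)⁻¹ * F z z' :=
    fun z hz z' hz' => by rw [h.eq z hz z' hz']
  rw [Finset.sum_congr rfl fun z hz => Finset.sum_congr rfl (this z hz)]
  refine Finset.sum_comm' fun z z' => ⟨fun ⟨h1, h2⟩ => ⟨?_, h.sub z h1 h2⟩, fun ⟨h1, h2⟩ => ⟨h.sub z' h2 h1, ?_⟩⟩
  · rw [h.eq z h1 z' h2]; exact h.self z h1
  · rw [h.eq z' h2 z h1]; exact h.self z' h2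

lemma Prt.card_pos {X : Type} {Ω : Finset X} {cl : X → Finset X} (h : Prt Ω cl) {z : X} (hz : z ∈ Ω) :
    (0 : ℝ) < (cl z).card := by
  exact_mod_cast Finset.card_pos.2 ⟨z, h.self z hz⟩

lemma Prt.avg {X : Type} [DecidableEq X] {Ω : Finset X} {cl : X → Finset X} (h : Prt Ω cl) (F : X → ℝ) :
    ∑ z ∈ Ω, ((cl z).card : ℝ)⁻¹ * ∑ z' ∈ cl z, F z' = ∑ z ∈ Ω, F z := by
  rw [h.swap fun _ z' => F z']
  refine Finset.sum_congr rfl fun z hz => ?_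
  rw [Finset.sum_const, nsmul_eq_mul, inv_mul_cancel_left₀ (h.card_pos hz).ne']

lemma Dy.Qle {X : Type} [DecidableEq X] (D : Dy X) {k m : ℕ} (hkm : k ≤ m) {z z' : X}
    (h : D.Q k z = D.Q k z') : D.Q m z = D.Q m z' := by
  induction m, hkm using Nat.le_induction with
  | base => exact h
  | succ n _ ih => exact D.Qs _ _ _ ih

lemma cz_decomp {X : Type} [DecidableEq X] (D : Dy X) (S : Finset X) (f : X → ℝ) (hf : ∀ z ∉ S, f z = 0)
    (t : ℝ) (ht : 0 < t) : ∃ (Ω : Finset X) (κ : X → ℕ),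
      Prt Ω (fun z => D.cell (κ z) (D.Q (κ z) z)) ∧
      (∀ z ∈ Ω, ∀ z', D.Q (κ z) z' = D.Q (κ z) z → κ z' = κ z) ∧
      (∀ z ∈ Ω, t * (D.cell (κ z) (D.Q (κ z) z)).card ≤ ∑ z' ∈ D.cell (κ z) (D.Q (κ z) z), |f z'|) ∧
      (∀ z ∈ Ω, ∑ z' ∈ D.cell (κ z) (D.Q (κ z) z), |f z'| ≤ t * D.B * (D.cell (κ z) (D.Q (κ z) z)).card) ∧
      (∀ z ∉ Ω, |f z| ≤ t) := by
  classical
  have hB0 : 0 < D.B := zero_lt_one.trans D.hB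
  set N := ∑ z ∈ S, |f z|
  have hN : ∀ s : Finset X, ∑ z ∈ s, |f z| ≤ N := fun s => by
    refine (Finset.sum_le_sum_of_subset_of_nonneg (Finset.subset_union_left (s₂ := S))
      fun _ _ _ => abs_nonneg _).trans (le_of_eq ?_)
    refine (Finset.sum_subset Finset.subset_union_right fun j _ hj => ?_).symm
    rw [hf j hj, abs_zero]
  set P : X → ℕ → Prop := fun z k => t * D.B ^ k < ∑ z' ∈ D.cell k (D.Q k z), |f z'| with hP
  obtain ⟨M, hM⟩ : ∃ M : ℕ, ∀ z, ∀ k, M ≤ k → ¬ P z k := by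
    obtain ⟨M, hM⟩ := pow_unbounded_of_one_lt (N / t) D.hB
    refine ⟨M, fun z k hk h => ?_⟩
    rw [div_lt_iff₀ ht] at hM
    have h1 : D.B ^ M ≤ D.B ^ k := pow_le_pow_right₀ D.hB.le hk
    have := hN (D.cell k (D.Q k z))
    simp only [hP] at h
    nlinarith
  have hPc : ∀ z z' k m, D.Q k z = D.Q k z' → k ≤ m → (P z m ↔ P z' m) := fun z z' k m h hkm => by
    simp only [hP]; rw [D.Qle hkm h]
  set κ : X → ℕ := fun z => Nat.findGreatest (P z) M with hκ
  have hκc : ∀ z z', P z (κ z) → D.Q (κ z) z' = D.Q (κ z) z → κ z' = κ z := fun z z' hz h => by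
    have hle : κ z ≤ M := Nat.findGreatest_le M
    show Nat.findGreatest (P z') M = κ z
    rw [Nat.findGreatest_eq_iff]
    refine ⟨hle, fun _ => (hPc z z' _ _ h.symm le_rfl).1 hz, fun n hn hnM hp => ?_⟩
    have := (hPc z z' _ n h.symm hn.le).2 hp
    exact absurd (Nat.le_findGreatest hnM this) (not_le.2 hn)
  have hκP : ∀ z k, P z k → P z (κ z) := fun z k hk => by
    have : k ≤ M := by by_contra hh; exact hM z k (by omega) hk
    exact Nat.findGreatest_spec this hk
  set Ω : Finset X := ((S ×ˢ Finset.range (M + 1)).biUnion fun a => D.cell a.2 (D.Q a.2 a.1)).filter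
    fun z => P z (κ z) with hΩ
  have hΩm : ∀ z, z ∈ Ω ↔ P z (κ z) := fun z => by
    rw [hΩ, Finset.mem_filter, and_iff_right_iff_imp]
    intro h
    have : ∃ z' ∈ D.cell (κ z) (D.Q (κ z) z), f z' ≠ 0 := by
      by_contra! hh
      simp only [hP] at h
      rw [Finset.sum_eq_zero fun z' hz' => by rw [hh z' hz', abs_zero]] at h
      exact absurd h (not_lt.2 (by positivity))
    obtain ⟨z', h1, h2⟩ := this
    rw [D.mem] at h1
    simp only [Finset.mem_biUnion, Finset.mem_product, Finset.mem_range, D.mem]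
    refine ⟨(z', κ z), ⟨by_contra fun h3 => h2 (hf _ h3), Nat.lt_succ_of_le (Nat.findGreatest_le M)⟩, h1.symm⟩
  refine ⟨Ω, κ, ⟨fun z hz z' hz' => ?_, fun z hz z' hz' => ?_, fun z hz => (D.mem _ _ _).2 rfl⟩,
    fun z hz z' h => hκc z z' ((hΩm z).1 hz) h, fun z hz => ?_, fun z hz => ?_, fun z hz => ?_⟩
  · rw [D.mem] at hz'
    rw [hΩm] at hz ⊢
    rw [hκc z z' hz hz']
    exact (hPc z z' _ _ hz'.symm le_rfl).1 hz
  · rw [D.mem] at hz'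
    rw [hΩm] at hz
    show D.cell (κ z') (D.Q (κ z') z') = _
    rw [hκc z z' hz hz', hz']
  · rw [D.card]; exact ((hΩm z).1 hz).le
  · rw [D.card]
    have h1 : ¬ P z (κ z + 1) := fun h => by
      have : κ z + 1 ≤ M := by by_contra hh; exact hM z _ (by omega) h
      have := Nat.le_findGreatest this h
      change κ z + 1 ≤ κ z at this
      omega
    simp only [hP, not_lt] at h1
    calc _ ≤ ∑ z' ∈ D.cell (κ z + 1) (D.Q (κ z + 1) z), |f z'| := by
          refine Finset.sum_le_sum_of_subset_of_nonneg (fun z' hz' => ?_) fun _ _ _ => abs_nonneg _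
          rw [D.mem] at hz' ⊢
          exact D.Qs _ _ _ hz'
      _ ≤ _ := h1
      _ = _ := by ring
  · by_contra! h
    refine hz ((hΩm z).2 (hκP z 0 ?_))
    simp only [hP, pow_zero, mul_one]
    refine h.trans_le (Finset.single_le_sum (f := fun z => |f z|) (fun _ _ => abs_nonneg _) ((D.mem _ _ _).2 rfl))

structure CZK {X : Type} [DecidableEq X] (D : Dy X) (C : ℝ) (K : X → X → ℝ) : Prop where
  l2 : ∀ (S W : Finset X) (f : X → ℝ), ∑ w ∈ W, (∑ z ∈ S, K w z * f z) ^ 2 ≤ C * ∑ z ∈ S, (f z) ^ 2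
  hor : ∀ k z z', D.Q k z = D.Q k z' → ∀ W : Finset X, Disjoint W (D.star k (D.Q k z)) →
    ∑ w ∈ W, |K w z - K w z'| ≤ C

lemma card_markov {X : Type} [DecidableEq X] (W : Finset X) (F : X → ℝ) (t : ℝ) (ht : 0 < t) (s : Finset X)
    (hs : s ⊆ W) (h : ∀ w ∈ s, t ≤ F w) (h0 : ∀ w, 0 ≤ F w) : (s.card : ℝ) ≤ t⁻¹ * ∑ w ∈ W, F w := by
  rw [← div_eq_inv_mul, le_div_iff₀ ht]
  calc (s.card : ℝ) * t = ∑ w ∈ s, t := by simp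
    _ ≤ ∑ w ∈ s, F w := Finset.sum_le_sum h
    _ ≤ _ := Finset.sum_le_sum_of_subset_of_nonneg hs fun _ _ _ => h0 _

lemma weak_one {X : Type} [DecidableEq X] (D : Dy X) (C : ℝ) (hC : 0 ≤ C) (K : X → X → ℝ) (hK : CZK D C K)
    (S W : Finset X) (f : X → ℝ) (t : ℝ) (ht : 0 < t) :
    ((W.filter fun w => 2 * t < |∑ z ∈ S, K w z * f z|).card : ℝ) ≤
      (D.A + C * D.B + C) * t⁻¹ * ∑ z ∈ S, |f z| := by
  classical
  have hB0 : 0 < D.B := zero_lt_one.trans D.hB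
  -- WLOG f vanishes off S
  obtain ⟨f', hf', hff⟩ : ∃ f' : X → ℝ, (∀ j ∉ S, f' j = 0) ∧ ∀ j ∈ S, f j = f' j :=
    ⟨fun j => if j ∈ S then f j else 0, fun j hj => if_neg hj, fun j hj => (if_pos hj).symm⟩
  have hJ : ∑ z ∈ S, |f z| = ∑ z ∈ S, |f' z| := Finset.sum_congr rfl fun j hj => by rw [hff j hj]
  have hWW : ∀ w, ∑ z ∈ S, K w z * f z = ∑ z ∈ S, K w z * f' z :=
    fun n => Finset.sum_congr rfl fun j hj => by rw [hff j hj]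
  rw [hJ]; simp only [hWW]
  clear hJ hWW hff
  generalize f' = f at hf'
  obtain ⟨Ω, κ, hp, hκ, h1, h2, h3⟩ := cz_decomp D S f hf' t ht
  set cl : X → Finset X := fun z => D.cell (κ z) (D.Q (κ z) z) with hcl
  set N := ∑ z ∈ S, |f z| with hNdef
  have hN : ∀ s : Finset X, ∑ z ∈ s, |f z| ≤ N := fun s => by
    refine (Finset.sum_le_sum_of_subset_of_nonneg (Finset.subset_union_left (s₂ := S))
      fun _ _ _ => abs_nonneg _).trans (le_of_eq ?_)
    refine (Finset.sum_subset Finset.subset_union_right fun j _ hj => ?_).symm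
    rw [hf' j hj, abs_zero]
  have hN0 : 0 ≤ N := Finset.sum_nonneg fun _ _ => abs_nonneg _
  -- size of Ω
  have hΩ : (Ω.card : ℝ) ≤ t⁻¹ * N := by
    calc (Ω.card : ℝ) = ∑ z ∈ Ω, 1 := by simp
      _ ≤ ∑ z ∈ Ω, t⁻¹ * (((cl z).card : ℝ)⁻¹ * ∑ z' ∈ cl z, |f z'|) := by
        refine Finset.sum_le_sum fun z hz => ?_
        have := hp.card_pos hz
        rw [← mul_assoc, ← mul_inv, ← div_eq_inv_mul, le_div_iff₀ (by positivity), one_mul]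
        exact h1 z hz
      _ = t⁻¹ * ∑ z ∈ Ω, |f z| := by rw [← Finset.mul_sum, hp.avg]
      _ ≤ _ := mul_le_mul_of_nonneg_left (hN _) (by positivity)
  set st : X → Finset X := fun z => D.star (κ z) (D.Q (κ z) z) with hst
  set Ωs : Finset X := Ω.biUnion st with hΩs
  have hΩsc : (Ωs.card : ℝ) ≤ D.A * (t⁻¹ * N) := by
    calc (Ωs.card : ℝ) = ∑ w ∈ Ωs, 1 := by simp
      _ ≤ ∑ w ∈ Ωs, ∑ z ∈ Ω, ((cl z).card : ℝ)⁻¹ * (if w ∈ st z then 1 else 0) := by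
        refine Finset.sum_le_sum fun w hw => ?_
        obtain ⟨z, hz, hw⟩ := Finset.mem_biUnion.1 hw
        calc (1 : ℝ) = ∑ z' ∈ cl z, ((cl z).card : ℝ)⁻¹ := by
              rw [Finset.sum_const, nsmul_eq_mul, mul_inv_cancel₀ (hp.card_pos hz).ne']
          _ = ∑ z' ∈ cl z, ((cl z').card : ℝ)⁻¹ * (if w ∈ st z' then 1 else 0) := by
              refine Finset.sum_congr rfl fun z' hz' => ?_
              have hq : D.Q (κ z) z' = D.Q (κ z) z := (D.mem _ _ _).1 hz'
              have hk := hκ z hz z' hq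
              have : st z' = st z := by simp only [hst]; rw [hk, hq]
              rw [this, if_pos hw, mul_one, hp.eq z hz z' hz']
          _ ≤ _ := Finset.sum_le_sum_of_subset_of_nonneg (hp.sub z hz) fun _ _ _ => by positivity
      _ = ∑ z ∈ Ω, ∑ w ∈ Ωs, ((cl z).card : ℝ)⁻¹ * (if w ∈ st z then 1 else 0) := Finset.sum_comm
      _ ≤ ∑ z ∈ Ω, D.A := by
        refine Finset.sum_le_sum fun z hz => ?_
        have hpz := hp.card_pos hz
        rw [← Finset.mul_sum, ← div_eq_inv_mul, div_le_iff₀ hpz, Finset.sum_ite_mem]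
        have : ((st z).card : ℝ) ≤ D.A * (cl z).card := by
          simp only [hst, hcl]; rw [D.card]; exact D.starc _ _
        refine le_trans ?_ this
        rw [Finset.sum_const, nsmul_eq_mul, mul_one]
        exact_mod_cast Finset.card_le_card Finset.inter_subset_right
      _ = D.A * Ω.card := by simp [mul_comm]
      _ ≤ _ := mul_le_mul_of_nonneg_left hΩ D.hA
  set m : X → ℝ := fun z => ((cl z).card : ℝ)⁻¹ * ∑ z' ∈ cl z, f z' with hm
  set g : X → ℝ := fun z => if z ∈ Ω then m z else f z with hg
  have hm1 : ∀ z, |m z| ≤ ((cl z).card : ℝ)⁻¹ * ∑ z' ∈ cl z, |f z'| := fun z => by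
    simp only [hm]
    rw [abs_mul, abs_of_nonneg (by positivity : (0 : ℝ) ≤ ((cl z).card : ℝ)⁻¹)]
    exact mul_le_mul_of_nonneg_left (Finset.abs_sum_le_sum_abs _ _) (by positivity)
  have hgB : ∀ z, |g z| ≤ t * D.B := fun z => by
    simp only [hg]
    split_ifs with hz
    · refine (hm1 z).trans ?_
      rw [← div_eq_inv_mul, div_le_iff₀ (hp.card_pos hz)]
      exact h2 z hz
    · refine (h3 z hz).trans ?_
      nlinarith [D.hB]
  have hg1 : ∑ z ∈ S ∪ Ω, |g z| ≤ N := by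
    have e : S ∪ Ω = (S \ Ω) ∪ Ω := by simp
    have hd : Disjoint (S \ Ω) Ω := Finset.sdiff_disjoint
    calc ∑ z ∈ S ∪ Ω, |g z| = ∑ z ∈ S \ Ω, |g z| + ∑ z ∈ Ω, |g z| := by
          rw [e, Finset.sum_union hd]
      _ ≤ ∑ z ∈ S \ Ω, |f z| + ∑ z ∈ Ω, |f z| := by
        refine add_le_add (le_of_eq (Finset.sum_congr rfl fun z hz => ?_)) ?_
        · simp only [hg]; rw [if_neg (Finset.mem_sdiff.1 hz).2]
        · rw [← hp.avg fun z => |f z|]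
          refine Finset.sum_le_sum fun z hz => ?_
          simp only [hg]; rw [if_pos hz]; exact hm1 z
      _ = ∑ z ∈ S ∪ Ω, |f z| := by rw [e, Finset.sum_union hd]
      _ ≤ N := hN _
  have hg2 : ∑ z ∈ S ∪ Ω, (g z) ^ 2 ≤ t * D.B * N := by
    calc ∑ z ∈ S ∪ Ω, (g z) ^ 2 ≤ ∑ z ∈ S ∪ Ω, t * D.B * |g z| := by
          refine Finset.sum_le_sum fun z _ => ?_
          rw [← sq_abs, sq]
          exact mul_le_mul_of_nonneg_right (hgB z) (abs_nonneg _)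
      _ = t * D.B * ∑ z ∈ S ∪ Ω, |g z| := by rw [Finset.mul_sum]
      _ ≤ _ := mul_le_mul_of_nonneg_left hg1 (by positivity)
  set Tg : X → ℝ := fun w => ∑ z ∈ S ∪ Ω, K w z * g z with hTg
  set Tb : X → ℝ := fun w => ∑ z ∈ Ω, K w z * (f z - m z) with hTb
  have hT : ∀ w, ∑ z ∈ S, K w z * f z = Tg w + Tb w := fun w => by
    have e1 : ∑ z ∈ S, K w z * f z = ∑ z ∈ S ∪ Ω, K w z * f z :=
      Finset.sum_subset Finset.subset_union_left fun z _ hz => by rw [hf' z hz, mul_zero]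
    have e2 : Tb w = ∑ z ∈ S ∪ Ω, K w z * (f z - g z) := by
      simp only [hTb]
      rw [← Finset.sum_subset (Finset.subset_union_right (s₁ := S) (s₂ := Ω))
        (f := fun z => K w z * (f z - g z))
        fun z _ hz => by simp only [hg]; rw [if_neg hz, sub_self, mul_zero]]
      refine Finset.sum_congr rfl fun z hz => ?_
      simp only [hg]; rw [if_pos hz]
    rw [e1, e2, hTg, ← Finset.sum_add_distrib]
    exact Finset.sum_congr rfl fun z _ => by ring
  have hTb' : ∀ w, Tb w = ∑ z ∈ Ω, ((cl z).card : ℝ)⁻¹ * ∑ z' ∈ cl z, (K w z - K w z') * f z := fun w => by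
    have e1 : ∑ z ∈ Ω, K w z * m z = ∑ z ∈ Ω, ((cl z).card : ℝ)⁻¹ * ∑ z' ∈ cl z, K w z' * f z := by
      rw [← hp.swap fun z z' => K w z * f z']
      refine Finset.sum_congr rfl fun z hz => ?_
      simp only [hm]; rw [← Finset.mul_sum]; ring
    have e2 : ∑ z ∈ Ω, K w z * f z = ∑ z ∈ Ω, ((cl z).card : ℝ)⁻¹ * ∑ z' ∈ cl z, K w z * f z := by
      refine Finset.sum_congr rfl fun z hz => ?_
      rw [Finset.sum_const, nsmul_eq_mul, inv_mul_cancel_left₀ (hp.card_pos hz).ne']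
    simp only [hTb, mul_sub]
    rw [Finset.sum_sub_distrib, e1, e2, ← Finset.sum_sub_distrib]
    refine Finset.sum_congr rfl fun z hz => ?_
    rw [← mul_sub, ← Finset.sum_sub_distrib]
    simp only [sub_mul]
  have hTbs : ∑ w ∈ W \ Ωs, |Tb w| ≤ C * N := by
    calc ∑ w ∈ W \ Ωs, |Tb w|
        ≤ ∑ w ∈ W \ Ωs, ∑ z ∈ Ω, ((cl z).card : ℝ)⁻¹ * ∑ z' ∈ cl z, |K w z - K w z'| * |f z| := by
          refine Finset.sum_le_sum fun w _ => ?_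
          rw [hTb']
          refine (Finset.abs_sum_le_sum_abs _ _).trans (Finset.sum_le_sum fun z _ => ?_)
          rw [abs_mul, abs_of_nonneg (by positivity : (0 : ℝ) ≤ ((cl z).card : ℝ)⁻¹)]
          refine mul_le_mul_of_nonneg_left ?_ (by positivity)
          refine (Finset.abs_sum_le_sum_abs _ _).trans (le_of_eq ?_)
          simp only [abs_mul]
      _ = ∑ z ∈ Ω, ((cl z).card : ℝ)⁻¹ * ∑ z' ∈ cl z, (∑ w ∈ W \ Ωs, |K w z - K w z'|) * |f z| := by
          rw [Finset.sum_comm]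
          refine Finset.sum_congr rfl fun z _ => ?_
          rw [← Finset.mul_sum, Finset.sum_comm]
          simp only [Finset.sum_mul]
      _ ≤ ∑ z ∈ Ω, ((cl z).card : ℝ)⁻¹ * ∑ z' ∈ cl z, C * |f z| := by
          refine Finset.sum_le_sum fun z hz => mul_le_mul_of_nonneg_left
            (Finset.sum_le_sum fun z' hz' => mul_le_mul_of_nonneg_right ?_ (abs_nonneg _)) (by positivity)
          have hq : D.Q (κ z) z' = D.Q (κ z) z := (D.mem _ _ _).1 hz'
          refine hK.hor (κ z) z z' hq.symm _ ?_
          refine Finset.disjoint_of_subset_right (Finset.subset_biUnion_of_mem st hz) ?_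
          exact Finset.sdiff_disjoint
      _ = ∑ z ∈ Ω, C * |f z| := by
          refine Finset.sum_congr rfl fun z hz => ?_
          rw [Finset.sum_const, nsmul_eq_mul, inv_mul_cancel_left₀ (hp.card_pos hz).ne']
      _ = C * ∑ z ∈ Ω, |f z| := by rw [Finset.mul_sum]
      _ ≤ _ := mul_le_mul_of_nonneg_left (hN _) hC
  have hsub : (W.filter fun w => 2 * t < |∑ z ∈ S, K w z * f z|) ⊆
      Ωs ∪ ((W.filter fun w => t < |Tg w|) ∪ ((W \ Ωs).filter fun w => t < |Tb w|)) := fun w hw => by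
    rw [Finset.mem_filter, hT] at hw
    simp only [Finset.mem_union, Finset.mem_filter, Finset.mem_sdiff]
    by_cases h : w ∈ Ωs
    · exact Or.inl h
    · by_cases h' : t < |Tg w|
      · exact Or.inr (Or.inl ⟨hw.1, h'⟩)
      · refine Or.inr (Or.inr ⟨⟨hw.1, h⟩, ?_⟩)
        have := abs_add_le (Tg w) (Tb w)
        linarith [hw.2]
  have hc1 : ((W.filter fun w => t < |Tg w|).card : ℝ) ≤ (t ^ 2)⁻¹ * (C * (t * D.B * N)) := by
    refine (card_markov W (fun w => (Tg w) ^ 2) (t ^ 2) (by positivity) _ (Finset.filter_subset _ _)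
      (fun w hw => ?_) fun w => sq_nonneg _).trans ?_
    · rw [← sq_abs (Tg w)]
      exact pow_le_pow_left₀ ht.le (Finset.mem_filter.1 hw).2.le 2
    · refine mul_le_mul_of_nonneg_left ((hK.l2 _ _ _).trans ?_) (by positivity)
      exact mul_le_mul_of_nonneg_left hg2 hC
  have hc2 : (((W \ Ωs).filter fun w => t < |Tb w|).card : ℝ) ≤ t⁻¹ * (C * N) := by
    refine (card_markov (W \ Ωs) (fun w => |Tb w|) t ht _ (Finset.filter_subset _ _)
      (fun w hw => (Finset.mem_filter.1 hw).2.le) fun w => abs_nonneg _).trans ?_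
    exact mul_le_mul_of_nonneg_left hTbs (by positivity)
  have e : (t ^ 2)⁻¹ * (C * (t * D.B * N)) = C * D.B * t⁻¹ * N := by field_simp
  have hcard : ((W.filter fun w => 2 * t < |∑ z ∈ S, K w z * f z|).card : ℝ) ≤ Ωs.card +
      ((W.filter fun w => t < |Tg w|).card + ((W \ Ωs).filter fun w => t < |Tb w|).card) := by
    exact_mod_cast (Finset.card_le_card hsub).trans ((Finset.card_union_le _ _).trans
      (Nat.add_le_add_left (Finset.card_union_le _ _) _))
  rw [e] at hc1
  calc _ ≤ _ := hcard
    _ ≤ D.A * (t⁻¹ * N) + (C * D.B * t⁻¹ * N + t⁻¹ * (C * N)) := by linarith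
    _ = _ := by ring

lemma lin_A (q t : ℝ) (hq : 0 < q) (ht : 0 ≤ t) :
    ∫⁻ s in Set.Ioi (0 : ℝ), ENNReal.ofReal (if s < t then s ^ (q - 1) else 0) = ENNReal.ofReal (t ^ q / q) := by
  have e1 : ∀ s : ℝ, ENNReal.ofReal (if s < t then s ^ (q - 1) else 0) =
      (Set.Iio t).indicator (fun s => ENNReal.ofReal (s ^ (q - 1))) s := fun s => by
    by_cases h : s < t
    · simp [h]
    · simp [h]
  simp only [e1]
  rw [MeasureTheory.lintegral_indicator measurableSet_Iio, MeasureTheory.Measure.restrict_restrict measurableSet_Iio,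
    Set.Iio_inter_Ioi, MeasureTheory.setLIntegral_congr MeasureTheory.Ioo_ae_eq_Ioc]
  have hi := intervalIntegral.intervalIntegrable_rpow' (a := 0) (b := t) (r := q - 1) (by linarith)
  rw [intervalIntegrable_iff_integrableOn_Ioc_of_le ht] at hi
  rw [← MeasureTheory.ofReal_integral_eq_lintegral_ofReal hi, ← intervalIntegral.integral_of_le ht,
    integral_rpow (Or.inl (by linarith))]
  · congr 1
    rw [sub_add_cancel, Real.zero_rpow hq.ne', sub_zero]
  · refine (MeasureTheory.ae_restrict_iff' measurableSet_Ioc).2 (Filter.Eventually.of_forall fun s hs => ?_)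
    exact Real.rpow_nonneg hs.1.le _

lemma lin_B (q a : ℝ) (hq : 0 < q) (ha : 0 < a) :
    ∫⁻ s in Set.Ioi (0 : ℝ), ENNReal.ofReal (if a ≤ s then s ^ (-q - 1) else 0) = ENNReal.ofReal (a ^ (-q) / q) := by
  have e1 : ∀ s : ℝ, ENNReal.ofReal (if a ≤ s then s ^ (-q - 1) else 0) =
      (Set.Ici a).indicator (fun s => ENNReal.ofReal (s ^ (-q - 1))) s := fun s => by
    by_cases h : a ≤ s
    · simp [h]
    · simp [h]
  simp only [e1]
  rw [MeasureTheory.lintegral_indicator measurableSet_Ici, MeasureTheory.Measure.restrict_restrict measurableSet_Ici,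
    show Set.Ici a ∩ Set.Ioi 0 = Set.Ici a from Set.inter_eq_left.2 fun s hs => ha.trans_le hs,
    MeasureTheory.setLIntegral_congr MeasureTheory.Ioi_ae_eq_Ici.symm]
  have hi := integrableOn_Ioi_rpow_of_lt (a := -q - 1) (by linarith) ha
  rw [← MeasureTheory.ofReal_integral_eq_lintegral_ofReal hi, integral_Ioi_rpow_of_lt (by linarith) ha]
  · congr 1
    rw [sub_add_cancel, neg_div_neg_eq]
  · refine (MeasureTheory.ae_restrict_iff' measurableSet_Ioi).2 (Filter.Eventually.of_forall fun s hs => ?_)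
    exact Real.rpow_nonneg (ha.trans hs).le _

lemma meas_A (q t : ℝ) : Measurable fun s : ℝ => if s < t then s ^ (q - 1) else 0 :=
  Measurable.ite measurableSet_Iio (by fun_prop) measurable_const
lemma meas_B (q t : ℝ) : Measurable fun s : ℝ => if t ≤ s then s ^ q else 0 :=
  Measurable.ite measurableSet_Ici (by fun_prop) measurable_const

lemma level_est {X : Type} [DecidableEq X] (D : Dy X) (C : ℝ) (hC : 0 ≤ C) (K : X → X → ℝ) (hK : CZK D C K)
    (S W : Finset X) (f : X → ℝ) (t : ℝ) (ht : 0 < t) :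
    ((W.filter fun w => t < |∑ z ∈ S, K w z * f z| / 4).card : ℝ) ≤
      (D.A + C * D.B + C) * t⁻¹ * (∑ z ∈ S, if t < |f z| then |f z| else 0) +
      C * (t ^ 2)⁻¹ * (∑ z ∈ S, if |f z| ≤ t then (f z) ^ 2 else 0) := by
  classical
  set f1 : X → ℝ := fun z => if t < |f z| then f z else 0 with hf1
  set f2 : X → ℝ := fun z => if |f z| ≤ t then f z else 0 with hf2
  have hs : ∀ w, ∑ z ∈ S, K w z * f z = ∑ z ∈ S, K w z * f1 z + ∑ z ∈ S, K w z * f2 z := fun w => by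
    rw [← Finset.sum_add_distrib]
    refine Finset.sum_congr rfl fun z _ => ?_
    simp only [hf1, hf2]
    by_cases h : t < |f z|
    · rw [if_pos h, if_neg (not_le.2 h)]; ring
    · rw [if_neg h, if_pos (not_lt.1 h)]; ring
  have h1 := weak_one D C hC K hK S W f1 t ht
  have e1 : ∑ z ∈ S, |f1 z| = ∑ z ∈ S, if t < |f z| then |f z| else 0 :=
    Finset.sum_congr rfl fun z _ => by simp only [hf1]; split_ifs <;> simp
  have e2 : ∑ z ∈ S, (f2 z) ^ 2 = ∑ z ∈ S, if |f z| ≤ t then (f z) ^ 2 else 0 :=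
    Finset.sum_congr rfl fun z _ => by simp only [hf2]; split_ifs <;> simp
  have h2 : ((W.filter fun w => 2 * t < |∑ z ∈ S, K w z * f2 z|).card : ℝ) ≤
      C * (t ^ 2)⁻¹ * ∑ z ∈ S, (f2 z) ^ 2 := by
    refine (card_markov W (fun w => (∑ z ∈ S, K w z * f2 z) ^ 2) (t ^ 2) (by positivity) _
      (Finset.filter_subset _ _) (fun w hw => ?_) fun w => sq_nonneg _).trans ?_
    · rw [← sq_abs (∑ z ∈ S, K w z * f2 z)]
      exact pow_le_pow_left₀ ht.le (by linarith [(Finset.mem_filter.1 hw).2]) 2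
    · rw [mul_comm C, mul_assoc]
      exact mul_le_mul_of_nonneg_left (hK.l2 _ _ _) (by positivity)
  rw [e1] at h1
  rw [e2] at h2
  refine le_trans ?_ (add_le_add h1 h2)
  have : (W.filter fun w => t < |∑ z ∈ S, K w z * f z| / 4) ⊆
    (W.filter fun w => 2 * t < |∑ z ∈ S, K w z * f1 z|) ∪ (W.filter fun w => 2 * t < |∑ z ∈ S, K w z * f2 z|) := by
    intro w hw
    rw [Finset.mem_filter, hs] at hw
    simp only [Finset.mem_union, Finset.mem_filter]
    by_contra! h
    have a1 := h.1 hw.1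
    have a2 := h.2 hw.1
    have := abs_add_le (∑ z ∈ S, K w z * f1 z) (∑ z ∈ S, K w z * f2 z)
    linarith [hw.2]
  exact_mod_cast (Finset.card_le_card this).trans (Finset.card_union_le _ _)

lemma strong_lt {X : Type} [DecidableEq X] (D : Dy X) (C : ℝ) (hC : 0 ≤ C) (p : ℝ) (hp : 1 < p) (hp2 : p < 2) :
    ∃ C' : ℝ, 0 < C' ∧ ∀ K : X → X → ℝ, CZK D C K → ∀ (S W : Finset X) (f : X → ℝ),
      ∑ w ∈ W, |∑ z ∈ S, K w z * f z| ^ p ≤ C' * ∑ z ∈ S, |f z| ^ p := by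
  classical
  have hB0 : 0 < D.B := zero_lt_one.trans D.hB
  have hA := D.hA
  set Cw := D.A + C * D.B + C with hCw
  have hCw0 : 0 ≤ Cw := by positivity
  have hp1 : 0 < p - 1 := by linarith
  have hp2' : 0 < 2 - p := by linarith
  refine ⟨4 ^ p * p * (Cw / (p - 1) + C / (2 - p)) + 1, by positivity, fun K hK S W f => ?_⟩
  set T : X → ℝ := fun w => |∑ z ∈ S, K w z * f z| / 4 with hT
  have hT0 : ∀ w, 0 ≤ T w := fun w => by positivity
  have main : ENNReal.ofReal (∑ w ∈ W, T w ^ p / p) ≤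
      ENNReal.ofReal (∑ z ∈ S, (Cw / (p - 1) + C / (2 - p)) * |f z| ^ p) := by
    calc ENNReal.ofReal (∑ w ∈ W, T w ^ p / p)
        = ∑ w ∈ W, ∫⁻ s in Set.Ioi (0 : ℝ), ENNReal.ofReal (if s < T w then s ^ (p - 1) else 0) := by
          rw [ENNReal.ofReal_sum_of_nonneg fun w _ => by have := hT0 w; positivity]
          exact Finset.sum_congr rfl fun w _ => (lin_A p (T w) (by linarith) (hT0 w)).symm
      _ = ∫⁻ s in Set.Ioi (0 : ℝ), ∑ w ∈ W, ENNReal.ofReal (if s < T w then s ^ (p - 1) else 0) := by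
          rw [MeasureTheory.lintegral_finsetSum]
          exact fun w _ => (meas_A p (T w)).ennreal_ofReal
      _ ≤ ∫⁻ s in Set.Ioi (0 : ℝ), ∑ z ∈ S,
          (ENNReal.ofReal (Cw * |f z|) * ENNReal.ofReal (if s < |f z| then s ^ ((p - 1) - 1) else 0) +
           ENNReal.ofReal (C * |f z| ^ 2) * ENNReal.ofReal (if |f z| ≤ s then s ^ (-(2 - p) - 1) else 0)) := by
          refine MeasureTheory.setLIntegral_mono' measurableSet_Ioi fun s hs => ?_
          have hs0 : 0 < s := hs
          have n1 : ∀ r q : ℝ, 0 ≤ (if s < r then s ^ q else 0) := fun r q => by positivity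
          have n2 : ∀ r q : ℝ, 0 ≤ (if r ≤ s then s ^ q else 0) := fun r q => by positivity
          rw [← ENNReal.ofReal_sum_of_nonneg fun w _ => n1 _ _]
          have e : ∀ z, (ENNReal.ofReal (Cw * |f z|) * ENNReal.ofReal (if s < |f z| then s ^ ((p - 1) - 1) else 0) +
           ENNReal.ofReal (C * |f z| ^ 2) * ENNReal.ofReal (if |f z| ≤ s then s ^ (-(2 - p) - 1) else 0)) =
             ENNReal.ofReal ((Cw * |f z|) * (if s < |f z| then s ^ ((p - 1) - 1) else 0) +
              (C * |f z| ^ 2) * (if |f z| ≤ s then s ^ (-(2 - p) - 1) else 0)) := fun z => by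
            rw [← ENNReal.ofReal_mul (by positivity), ← ENNReal.ofReal_mul (by positivity),
              ENNReal.ofReal_add (mul_nonneg (by positivity) (n1 _ _)) (mul_nonneg (by positivity) (n2 _ _))]
          simp only [e]
          rw [← ENNReal.ofReal_sum_of_nonneg fun w _ => add_nonneg
            (mul_nonneg (by positivity) (n1 _ _)) (mul_nonneg (by positivity) (n2 _ _))]
          refine ENNReal.ofReal_le_ofReal ?_
          have hl := mul_le_mul_of_nonneg_left (level_est D C hC K hK S W f s hs0)
            (Real.rpow_nonneg hs0.le (p - 1))
          have r1 : s ^ ((p - 1) - 1) = s ^ (p - 1) * s⁻¹ := by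
            rw [Real.rpow_sub hs0, Real.rpow_one, div_eq_mul_inv]
          have r2 : s ^ (-(2 - p) - 1) = s ^ (p - 1) * (s ^ 2)⁻¹ := by
            rw [← Real.rpow_two, ← Real.rpow_neg hs0.le, ← Real.rpow_add hs0]; congr 1; ring
          calc _ = s ^ (p - 1) * ((W.filter fun w => s < T w).card : ℝ) := by
                rw [← Finset.sum_filter, Finset.sum_const, nsmul_eq_mul, mul_comm]
            _ ≤ _ := hl
            _ = _ := by
                rw [Finset.sum_add_distrib, mul_add, r1, r2]
                congr 1
                · rw [Finset.mul_sum, Finset.mul_sum]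
                  refine Finset.sum_congr rfl fun z _ => ?_
                  split_ifs <;> ring
                · rw [Finset.mul_sum, Finset.mul_sum]
                  refine Finset.sum_congr rfl fun z _ => ?_
                  rw [sq_abs]
                  split_ifs <;> ring
      _ = ∑ z ∈ S,
          (ENNReal.ofReal (Cw * |f z|) * ENNReal.ofReal (|f z| ^ (p - 1) / (p - 1)) +
           ENNReal.ofReal (C * |f z| ^ 2) * ENNReal.ofReal (|f z| ^ (-(2 - p)) / (2 - p))) := by
          rw [MeasureTheory.lintegral_finsetSum]
          swap
          · exact fun z _ => ((meas_A (p - 1) _).ennreal_ofReal.const_mul _).add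
              ((meas_B _ _).ennreal_ofReal.const_mul _)
          refine Finset.sum_congr rfl fun z _ => ?_
          rw [MeasureTheory.lintegral_add_left ((meas_A (p - 1) _).ennreal_ofReal.const_mul _),
            MeasureTheory.lintegral_const_mul _ (meas_A (p - 1) _).ennreal_ofReal,
            MeasureTheory.lintegral_const_mul _ (meas_B _ _).ennreal_ofReal,
            lin_A (p - 1) _ hp1 (abs_nonneg _)]
          congr 1
          rcases (abs_nonneg (f z)).eq_or_lt with h | h
          · rw [← h]; simp
          · rw [lin_B (2 - p) _ hp2' h]
      _ = _ := by
          rw [ENNReal.ofReal_sum_of_nonneg fun z _ => by positivity]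
          refine Finset.sum_congr rfl fun z _ => ?_
          rw [← ENNReal.ofReal_mul (by positivity), ← ENNReal.ofReal_mul (by positivity),
            ← ENNReal.ofReal_add (by positivity) (by positivity)]
          congr 1
          rcases (abs_nonneg (f z)).eq_or_lt with h | h
          · rw [← h]; simp [Real.zero_rpow (show (0 : ℝ) < p by linarith).ne']
          · have r1 : |f z| ^ p = |f z| * |f z| ^ (p - 1) := by
              rw [Real.rpow_sub h, Real.rpow_one]; field_simp
            have r2 : |f z| ^ p = |f z| ^ 2 * |f z| ^ (-(2 - p)) := by
              rw [← Real.rpow_two, ← Real.rpow_add h]; congr 1; ring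
            have r3 : Cw * |f z| * (|f z| ^ (p - 1) / (p - 1)) = Cw / (p - 1) * |f z| ^ p := by
              rw [r1]; ring
            have r4 : C * |f z| ^ 2 * (|f z| ^ (-(2 - p)) / (2 - p)) = C / (2 - p) * |f z| ^ p := by
              rw [r2]; ring
            rw [r3, r4]; ring
  rw [ENNReal.ofReal_le_ofReal_iff (Finset.sum_nonneg fun z _ => by positivity), ← Finset.mul_sum] at main
  have e : ∑ w ∈ W, |∑ z ∈ S, K w z * f z| ^ p = 4 ^ p * p * ∑ w ∈ W, T w ^ p / p := by
    rw [Finset.mul_sum]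
    refine Finset.sum_congr rfl fun w _ => ?_
    simp only [hT]
    rw [Real.div_rpow (abs_nonneg _) (by norm_num)]
    have : (0 : ℝ) < 4 ^ p := by positivity
    field_simp
  have hS : 0 ≤ ∑ z ∈ S, |f z| ^ p := Finset.sum_nonneg fun z _ => by positivity
  rw [e]
  have := mul_le_mul_of_nonneg_left main (show (0 : ℝ) ≤ 4 ^ p * p by positivity)
  nlinarith

lemma strong_le {X : Type} [DecidableEq X] (D : Dy X) (C : ℝ) (hC : 0 < C) (p : ℝ) (hp : 1 < p) (hp2 : p ≤ 2) :
    ∃ C' : ℝ, 0 < C' ∧ ∀ K : X → X → ℝ, CZK D C K → ∀ (S W : Finset X) (f : X → ℝ),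
      ∑ w ∈ W, |∑ z ∈ S, K w z * f z| ^ p ≤ C' * ∑ z ∈ S, |f z| ^ p := by
  rcases hp2.eq_or_lt with h | h
  · subst h
    refine ⟨C, hC, fun K hK S W f => ?_⟩
    have := hK.l2 S W f
    simpa only [Real.rpow_two, sq_abs] using this
  · exact strong_lt D C hC.le p hp h

lemma dual_est {X Y : Type} (p q : ℝ) (hpq : p.HolderConjugate q) (C : ℝ) (hC : 0 < C) (K : X → Y → ℝ)
    (S : Finset Y) (W : Finset X)
    (h : ∀ (f : Y → ℝ), ∑ w ∈ W, |∑ z ∈ S, K w z * f z| ^ p ≤ C * ∑ z ∈ S, |f z| ^ p)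
    (g : X → ℝ) : ∑ z ∈ S, |∑ w ∈ W, K w z * g w| ^ q ≤ C ^ (q / p) * ∑ w ∈ W, |g w| ^ q := by
  have hp0 := hpq.pos
  have hq0 := hpq.symm.pos
  have hq1 : 1 < q := hpq.symm.lt
  set H : Y → ℝ := fun z => ∑ w ∈ W, K w z * g w with hH
  set f : Y → ℝ := fun z => SignType.sign (H z) * |H z| ^ (q - 1) with hf
  have hfabs : ∀ z, |f z| ^ p = |H z| ^ q := fun z => by
    simp only [hf]
    rcases eq_or_ne (H z) 0 with h0 | h0
    · rw [h0, sign_zero]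
      simp [Real.zero_rpow hp0.ne', Real.zero_rpow hq0.ne']
    · rw [abs_mul, abs_of_nonneg (by positivity : 0 ≤ |H z| ^ (q - 1))]
      have : |((SignType.sign (H z) : SignType) : ℝ)| = 1 := by
        rcases lt_or_gt_of_ne h0 with h1 | h1
        · rw [sign_neg h1]; simp
        · rw [sign_pos h1]; simp
      rw [this, one_mul, ← Real.rpow_mul (abs_nonneg _)]
      congr 1
      have := hpq.symm.sub_one_mul_conj
      linarith
  have hfH : ∀ z, f z * H z = |H z| ^ q := fun z => by
    simp only [hf]
    rw [mul_right_comm, sign_mul_self]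
    rcases eq_or_ne (H z) 0 with h0 | h0
    · simp [h0, Real.zero_rpow hq0.ne']
    · have : 0 < |H z| := abs_pos.2 h0
      rw [Real.rpow_sub this, Real.rpow_one]; field_simp
  set M := ∑ z ∈ S, |H z| ^ q with hM
  have hM0 : 0 ≤ M := Finset.sum_nonneg fun z _ => by positivity
  have hG0 : 0 ≤ ∑ w ∈ W, |g w| ^ q := Finset.sum_nonneg fun z _ => by positivity
  have e1 : M = ∑ w ∈ W, (∑ z ∈ S, K w z * f z) * g w := by
    have : M = ∑ z ∈ S, ∑ w ∈ W, f z * (K w z * g w) := by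
      rw [hM]
      refine Finset.sum_congr rfl fun z _ => ?_
      rw [← hfH, ← Finset.mul_sum]
    rw [this, Finset.sum_comm]
    simp only [Finset.sum_mul]
    exact Finset.sum_congr rfl fun w _ => Finset.sum_congr rfl fun z _ => by ring
  have e2 : M ≤ (C * M) ^ (1 / p) * (∑ w ∈ W, |g w| ^ q) ^ (1 / q) := by
    have i1 := Real.inner_le_Lp_mul_Lq W (fun w => ∑ z ∈ S, K w z * f z) g hpq
    rw [← e1] at i1
    refine i1.trans (mul_le_mul_of_nonneg_right (Real.rpow_le_rpow
      (Finset.sum_nonneg fun z _ => by positivity) ?_ (by positivity)) (by positivity))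
    have := h f
    simpa only [hfabs] using this
  rcases hM0.eq_or_lt with h0 | h0
  · rw [← h0]; positivity
  · have e3 : M ^ (1 / q) ≤ C ^ (1 / p) * (∑ w ∈ W, |g w| ^ q) ^ (1 / q) := by
      rw [Real.mul_rpow hC.le hM0] at e2
      have : M = M ^ (1 / p) * M ^ (1 / q) := by
        rw [← Real.rpow_add h0, one_div, one_div, hpq.inv_add_inv_eq_one, Real.rpow_one]
      have hpos : 0 < M ^ (1 / p) := by positivity
      refine le_of_mul_le_mul_left ?_ hpos
      rw [← this]
      linarith
    have e4 := Real.rpow_le_rpow (by positivity) e3 hq0.le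
    rw [Real.mul_rpow (by positivity) (by positivity), ← Real.rpow_mul hM0, ← Real.rpow_mul hG0,
      ← Real.rpow_mul hC.le, one_div_mul_cancel hq0.ne', Real.rpow_one, Real.rpow_one,
      one_div_mul_eq_div] at e4
    exact e4

lemma div_iff_Ico (x c m : ℤ) (hm : 0 < m) : x / m = c ↔ x ∈ Finset.Ico (c * m) ((c + 1) * m) := by
  rw [Finset.mem_Ico, ← Int.le_ediv_iff_mul_le hm, ← Int.ediv_lt_iff_lt_mul hm]; omega

def dyZ (d : ℕ) : Dy (ℤ × (Fin d → ℤ)) where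
  Q k z := (z.1 / 4 ^ k, fun i => z.2 i / 2 ^ k)
  cell k c := Finset.Ico (c.1 * 4 ^ k) ((c.1 + 1) * 4 ^ k) ×ˢ
    Fintype.piFinset fun i => Finset.Ico (c.2 i * 2 ^ k) ((c.2 i + 1) * 2 ^ k)
  star k c := Finset.Ico ((c.1 - 3) * 4 ^ k) ((c.1 + 4) * 4 ^ k) ×ˢ
    Fintype.piFinset fun i => Finset.Ico ((c.2 i - 1) * 2 ^ k) ((c.2 i + 2) * 2 ^ k)
  B := 4 * 2 ^ d
  A := 7 * 3 ^ d
  hB := by have : (1 : ℝ) ≤ 2 ^ d := one_le_pow₀ (by norm_num); linarith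
  hA := by positivity
  Q0 z := by simp
  Qs k z z' h := by
    rw [Prod.mk.injEq] at h ⊢
    refine ⟨?_, ?_⟩
    · rw [pow_succ, ← Int.ediv_ediv_of_nonneg (by positivity), ← Int.ediv_ediv_of_nonneg (by positivity), h.1]
    · funext i
      rw [pow_succ, ← Int.ediv_ediv_of_nonneg (by positivity), ← Int.ediv_ediv_of_nonneg (by positivity)]
      rw [show z.2 i / 2 ^ k = z'.2 i / 2 ^ k from congrFun h.2 i]
  mem k c z := by
    rw [Finset.mem_product, Fintype.mem_piFinset, ← div_iff_Ico _ _ _ (by positivity)]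
    simp only [← div_iff_Ico _ _ ((2 : ℤ) ^ k) (by positivity)]
    rw [Prod.ext_iff, funext_iff]
  card k z := by
    rw [Finset.card_product, Fintype.card_piFinset]
    simp only [Int.card_Ico, ← sub_mul, add_sub_cancel_left, one_mul, Finset.prod_const, Finset.card_univ,
      Fintype.card_fin]
    rw [show ((4 : ℤ) ^ k).toNat = 4 ^ k by rw [Int.toNat_pow_of_nonneg (by norm_num)]; rfl,
      show ((2 : ℤ) ^ k).toNat = 2 ^ k by rw [Int.toNat_pow_of_nonneg (by norm_num)]; rfl]
    push_cast
    rw [mul_pow, ← pow_mul, ← pow_mul, mul_comm k d]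
  starc k c := by
    rw [Finset.card_product, Fintype.card_piFinset]
    simp only [Int.card_Ico, ← sub_mul]
    have e1 : ∀ a : ℤ, ((a + 4 - (a - 3)) * 4 ^ k).toNat = 7 * 4 ^ k := fun a => by
      rw [show a + 4 - (a - 3) = 7 by ring]
      rw [show (7 * 4 ^ k : ℤ) = ((7 * 4 ^ k : ℕ) : ℤ) by push_cast; ring, Int.toNat_natCast]
    have e2 : ∀ a : ℤ, ((a + 2 - (a - 1)) * 2 ^ k).toNat = 3 * 2 ^ k := fun a => by
      rw [show a + 2 - (a - 1) = 3 by ring]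
      rw [show (3 * 2 ^ k : ℤ) = ((3 * 2 ^ k : ℕ) : ℤ) by push_cast; ring, Int.toNat_natCast]
    simp only [e1, e2, Finset.prod_const, Finset.card_univ, Fintype.card_fin]
    push_cast
    refine le_of_eq ?_
    rw [mul_pow, mul_pow, ← pow_mul, ← pow_mul, mul_comm k d]; ring

lemma ser_a (R : ℕ) : ∑ N ∈ Finset.Icc 1 R, 1 / √(N : ℝ) ≤ 2 * √(R : ℝ) := by
  induction R with
  | zero => simp
  | succ R ih =>
    rw [Finset.sum_Icc_succ_top (by omega)]
    have h0 : 0 < √((R + 1 : ℕ) : ℝ) := Real.sqrt_pos.2 (by positivity)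
    have h1 : √(R : ℝ) ≤ √((R + 1 : ℕ) : ℝ) := Real.sqrt_le_sqrt (by push_cast; linarith)
    have s0 : √(R : ℝ) ^ 2 = R := Real.sq_sqrt (by positivity)
    have s1 : √((R + 1 : ℕ) : ℝ) ^ 2 = R + 1 := by rw [Real.sq_sqrt (by positivity)]; push_cast; ring
    have : 1 / √((R + 1 : ℕ) : ℝ) ≤ 2 * √((R + 1 : ℕ) : ℝ) - 2 * √(R : ℝ) := by
      rw [div_le_iff₀ h0]
      nlinarith [sq_nonneg (√((R + 1 : ℕ) : ℝ) - √(R : ℝ))]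
    linarith

lemma ser_b (R : ℕ) (hR : 1 ≤ R) (M : ℕ) :
    ∑ N ∈ Finset.Ioc R (R + M), 1 / ((N : ℝ) * √(N : ℝ)) ≤ 2 / √(R : ℝ) - 2 / √((R + M : ℕ) : ℝ) := by
  induction M with
  | zero => simp
  | succ M ih =>
    rw [← add_assoc, Finset.sum_Ioc_succ_top (by omega)]
    set x := R + M
    have hx : 0 < x := by omega
    have h0 : 0 < √(x : ℝ) := Real.sqrt_pos.2 (by positivity)
    have h1 : 0 < √((x + 1 : ℕ) : ℝ) := Real.sqrt_pos.2 (by positivity)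
    have s0 : √(x : ℝ) ^ 2 = x := Real.sq_sqrt (by positivity)
    have s1 : √((x + 1 : ℕ) : ℝ) ^ 2 = ((x + 1 : ℕ) : ℝ) := Real.sq_sqrt (by positivity)
    have s2 : ((x + 1 : ℕ) : ℝ) = x + 1 := by push_cast; ring
    have h2 : √(x : ℝ) ≤ √((x + 1 : ℕ) : ℝ) := Real.sqrt_le_sqrt (by push_cast; linarith)
    have : 1 / (((x + 1 : ℕ) : ℝ) * √((x + 1 : ℕ) : ℝ)) ≤ 2 / √(x : ℝ) - 2 / √((x + 1 : ℕ) : ℝ) := by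
      generalize √((x + 1 : ℕ) : ℝ) = v at *
      generalize √(x : ℝ) = u at *
      rw [← s1]
      have e : v ^ 2 = u ^ 2 + 1 := by rw [s1, s2, s0]
      rw [div_sub_div _ _ h0.ne' h1.ne', div_le_div_iff₀ (by positivity) (by positivity)]
      have h3 : 1 ≤ 2 * (v - u) * v := by nlinarith [sq_nonneg (v - u)]
      have h5 : (u * v) ≤ v * v := by nlinarith
      calc 1 * (u * v) ≤ 1 * (v * v) := by linarith
        _ ≤ (2 * (v - u) * v) * (v * v) := mul_le_mul_of_nonneg_right h3 (by positivity)
        _ = _ := by ring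
    linarith

lemma ser_a' (I : Finset ℤ) (j : ℤ) (R : ℕ) (hI : ∀ n ∈ I, 0 < n - j ∧ n - j ≤ R) :
    ∑ n ∈ I, 1 / √((n - j : ℤ) : ℝ) ≤ 2 * √(R : ℝ) := by
  refine le_trans ?_ (ser_a R)
  calc ∑ n ∈ I, 1 / √((n - j : ℤ) : ℝ) = ∑ N ∈ I.image (fun n => (n - j).toNat), 1 / √(N : ℝ) := by
        rw [Finset.sum_image fun x hx y hy h => ?_]
        · refine Finset.sum_congr rfl fun n hn => ?_
          have : (((n - j).toNat : ℕ) : ℤ) = n - j := Int.toNat_of_nonneg (hI n hn).1.le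
          rw [← this]; push_cast; rfl
        · have h1 := (hI x hx).1
          have h2 := (hI y hy).1
          omega
    _ ≤ _ := Finset.sum_le_sum_of_subset_of_nonneg (fun N hN => by
        obtain ⟨n, hn, rfl⟩ := Finset.mem_image.1 hN
        have := hI n hn
        rw [Finset.mem_Icc]; omega) fun _ _ _ => by positivity

lemma ser_b' (I : Finset ℤ) (j : ℤ) (R : ℕ) (hR : 1 ≤ R) (hI : ∀ n ∈ I, (R : ℤ) < n - j) :
    ∑ n ∈ I, 1 / (((n - j : ℤ) : ℝ) * √((n - j : ℤ) : ℝ)) ≤ 2 / √(R : ℝ) := by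
  obtain ⟨M, hM⟩ : ∃ M : ℕ, ∀ n ∈ I, n - j ≤ R + M := by
    obtain ⟨m, hm⟩ := I.bddAbove
    exact ⟨(m - j).toNat, fun n hn => by have := hm hn; omega⟩
  have hb : ∑ N ∈ Finset.Ioc R (R + M), 1 / ((N : ℝ) * √(N : ℝ)) ≤ 2 / √(R : ℝ) :=
    (ser_b R hR M).trans (sub_le_self _ (by positivity))
  refine le_trans ?_ hb
  calc ∑ n ∈ I, 1 / (((n - j : ℤ) : ℝ) * √((n - j : ℤ) : ℝ)) =
        ∑ N ∈ I.image (fun n => (n - j).toNat), 1 / ((N : ℝ) * √(N : ℝ)) := by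
        rw [Finset.sum_image fun x hx y hy h => ?_]
        · refine Finset.sum_congr rfl fun n hn => ?_
          have h3 := hI n hn
          have : (((n - j).toNat : ℕ) : ℤ) = n - j := Int.toNat_of_nonneg (by omega)
          rw [← this]; push_cast; rfl
        · have h1 := hI x hx
          have h2 := hI y hy
          omega
    _ ≤ _ := Finset.sum_le_sum_of_subset_of_nonneg (fun N hN => by
        obtain ⟨n, hn, rfl⟩ := Finset.mem_image.1 hN
        have h1 := hI n hn
        have h2 := hM n hn
        rw [Finset.mem_Ioc]; omega) fun _ _ _ => by positivity

lemma coeff_sum_le {d : ℕ} (φ : (Fin d → ℤ) → ℝ) (hφ : ∀ x, 0 ≤ φ x) (u : RR d) (s : Finset (Fin d → ℤ))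
    (y : Fin d → ℤ) : ∑ x ∈ s, |u.coeff (x - y)| * φ (x - y) ≤ wn φ u := by
  classical
  rw [← Finset.sum_image (g := fun x => x - y) (f := fun x => |u.coeff x| * φ x)
    (fun a _ b _ h => by simpa using h), wn, Finsupp.sum]
  refine (Finset.sum_le_sum_of_subset_of_nonneg (Finset.subset_union_left (s₂ := u.coeff.support))
    fun x _ _ => mul_nonneg (abs_nonneg _) (hφ x)).trans (le_of_eq ?_)
  refine (Finset.sum_subset Finset.subset_union_right fun j _ hj => ?_).symm
  rw [Finsupp.notMem_support_iff.1 hj, abs_zero, zero_mul]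

lemma coeff_sum_le_nm {d : ℕ} (u : RR d) (s : Finset (Fin d → ℤ))
    (y : Fin d → ℤ) : ∑ x ∈ s, |u.coeff (x - y)| ≤ nm u := by
  have := coeff_sum_le (fun _ => 1) (fun _ => zero_le_one) u s y
  simpa [nm] using this

lemma coeff_tau_mul {d : ℕ} (v x : Fin d → ℤ) (u : RR d) : (tau v * u).coeff x = u.coeff (x - v) := by
  rw [tau, AddMonoidAlgebra.coeff_single_mul_apply, one_mul, neg_add_eq_sub]

def ker {d : ℕ} (κ : ℤ → ℤ → RR d) (w z : ℤ × (Fin d → ℤ)) : ℝ := (κ z.1 w.1).coeff (w.2 - z.2)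

lemma slice {d : ℕ} (W : Finset (ℤ × (Fin d → ℤ))) (F : ℤ × (Fin d → ℤ) → ℝ) (Φ : ℤ → ℝ)
    (h : ∀ n ∈ W.image Prod.fst, ∀ s : Finset (Fin d → ℤ), (∀ x ∈ s, (n, x) ∈ W) → ∑ x ∈ s, F (n, x) ≤ Φ n) :
    ∑ w ∈ W, F w ≤ ∑ n ∈ W.image Prod.fst, Φ n := by
  classical
  rw [← Finset.sum_fiberwise_of_maps_to (g := Prod.fst) (t := W.image Prod.fst)
    fun w hw => Finset.mem_image_of_mem _ hw]
  refine Finset.sum_le_sum fun n hn => ?_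
  have e : ∑ w ∈ W with w.1 = n, F w = ∑ x ∈ (W.filter fun w => w.1 = n).image Prod.snd, F (n, x) := by
    rw [Finset.sum_image fun a ha b hb hab => ?_]
    · refine Finset.sum_congr rfl fun w hw => ?_
      rw [← (Finset.mem_filter.1 hw).2]
    · have h1 := (Finset.mem_filter.1 ha).2
      have h2 := (Finset.mem_filter.1 hb).2
      exact Prod.ext (h1.trans h2.symm) hab
  rw [e]
  refine h n hn _ fun x hx => ?_
  obtain ⟨w, hw, rfl⟩ := Finset.mem_image.1 hx
  obtain ⟨h1, h2⟩ := Finset.mem_filter.1 hw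
  rw [← h2]; exact h1

lemma hor_far {d : ℕ} {C : ℝ} {κ : ℤ → ℤ → RR d} (hC : 0 ≤ C) (hκ : KerEst C κ) (z : ℤ × (Fin d → ℤ))
    (R : ℕ) (r : ℝ) (hr : 0 < r) (W : Finset (ℤ × (Fin d → ℤ)))
    (hW : ∀ w ∈ W, z.1 < w.1 → w.1 - z.1 ≤ R ∧ r ≤ l1 (w.2 - z.2)) :
    ∑ w ∈ W, |ker κ w z| ≤ C / r * (2 * √(R : ℝ)) := by
  classical
  have e : ∑ w ∈ W, |ker κ w z| = ∑ w ∈ W with z.1 < w.1, |ker κ w z| := by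
    refine (Finset.sum_filter_of_ne fun w _ h => ?_).symm
    by_contra! h'
    refine h ?_
    rw [ker, hκ.zero _ _ h']; simp
  rw [e]
  refine (slice _ _ (fun n => C / r * (1 / √((n - z.1 : ℤ) : ℝ))) fun n hn s hs => ?_).trans ?_
  · obtain ⟨w, hw, rfl⟩ := Finset.mem_image.1 hn
    have hlt := (Finset.mem_filter.1 hw).2
    calc ∑ x ∈ s, |ker κ (w.1, x) z| ≤ ∑ x ∈ s, r⁻¹ * (|(κ z.1 w.1).coeff (x - z.2)| * l1 (x - z.2)) := by
          refine Finset.sum_le_sum fun x hx => ?_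
          have h1 := (hW _ (Finset.mem_filter.1 (hs x hx)).1 hlt).2
          rw [← mul_left_comm]
          refine le_mul_of_one_le_right (abs_nonneg _) ?_
          rw [← div_eq_inv_mul, le_div_iff₀ hr, one_mul]; exact h1
      _ = r⁻¹ * ∑ x ∈ s, (|(κ z.1 w.1).coeff (x - z.2)| * l1 (x - z.2)) := by rw [Finset.mul_sum]
      _ ≤ r⁻¹ * wt (κ z.1 w.1) := mul_le_mul_of_nonneg_left
          (coeff_sum_le l1 (fun x => Finset.sum_nonneg fun _ _ => abs_nonneg _) _ _ _) (by positivity)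
      _ ≤ r⁻¹ * (C / √((w.1 - z.1 : ℤ) : ℝ)) := mul_le_mul_of_nonneg_left (hκ.mom _ _ hlt) (by positivity)
      _ = _ := by ring
  · rw [← Finset.mul_sum]
    refine mul_le_mul_of_nonneg_left (ser_a' _ _ _ fun n hn => ?_) (by positivity)
    obtain ⟨w, hw, rfl⟩ := Finset.mem_image.1 hn
    obtain ⟨h1, h2⟩ := Finset.mem_filter.1 hw
    exact ⟨by omega, (hW w h1 h2).1⟩

lemma tm_iter {d : ℕ} {C : ℝ} {κ : ℤ → ℤ → RR d} (hC : 0 ≤ C) (hκ : KerEst C κ) (j n : ℤ) (hjn : j < n) (m : ℕ) :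
    nm (κ (j - m) n - κ j n) ≤ m * (C / ((n - j : ℤ) : ℝ) ^ 2) := by
  induction m with
  | zero => simp [nm, wn_zero]
  | succ m ih =>
    have h1 := hκ.tm (j - m) n (by omega)
    have e : κ (j - (m + 1 : ℕ)) n - κ j n = (κ (j - m - 1) n - κ (j - m) n) + (κ (j - m) n - κ j n) := by
      rw [show j - ((m + 1 : ℕ) : ℤ) = j - m - 1 by push_cast; ring]; ring
    rw [e]
    refine (wn_add (fun _ => zero_le_one) _ _).trans ?_
    have h2 : C / ((n - (j - m) : ℤ) : ℝ) ^ 2 ≤ C / ((n - j : ℤ) : ℝ) ^ 2 := by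
      have : (0 : ℝ) < ((n - j : ℤ) : ℝ) := by exact_mod_cast (show (0 : ℤ) < n - j by omega)
      refine div_le_div_of_nonneg_left hC (by positivity) (pow_le_pow_left₀ this.le ?_ 2)
      exact_mod_cast (show n - j ≤ n - (j - m) by omega)
    change nm (κ (j - m - 1) n - κ (j - m) n) + nm (κ (j - m) n - κ j n) ≤ _
    rw [Nat.cast_succ, add_mul, one_mul]
    linarith

lemma hor_near {d : ℕ} {C : ℝ} {κ : ℤ → ℤ → RR d} (hC : 0 ≤ C) (hκ : KerEst C κ) (z z' : ℤ × (Fin d → ℤ))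
    (R : ℕ) (r : ℝ) (hr : 0 < r) (hR : (R : ℝ) = r ^ 2) (W : Finset (ℤ × (Fin d → ℤ)))
    (h1 : z.1 ≤ z'.1) (h2 : z'.1 - z.1 ≤ R) (h3 : l1 (z.2 - z'.2) ≤ d * r)
    (hW : ∀ w ∈ W, (R : ℤ) < w.1 - z'.1) :
    ∑ w ∈ W, |ker κ w z - ker κ w z'| ≤ C * (1 + d) * 2 := by
  classical
  have hsR : √(R : ℝ) = r := by rw [hR, Real.sqrt_sq hr.le]
  have hR1 : 1 ≤ R := by
    have : (0 : ℝ) < R := by rw [hR]; positivity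
    exact_mod_cast this
  refine (slice _ _ (fun n => C * (1 + d) * r *
    (1 / (((n - z'.1 : ℤ) : ℝ) * √((n - z'.1 : ℤ) : ℝ)))) fun n hn s hs => ?_).trans ?_
  · obtain ⟨w, hw, rfl⟩ := Finset.mem_image.1 hn
    have hw' := hW w hw
    have hlt : z'.1 < w.1 := by omega
    set N : ℝ := ((w.1 - z'.1 : ℤ) : ℝ) with hN
    have hNR : (R : ℝ) ≤ N := by rw [hN]; exact_mod_cast hw'.le
    have hN0 : 0 < N := by rw [hR] at hNR; exact lt_of_lt_of_le (by positivity) hNR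
    have hsN : r ≤ √N := by rw [← hsR]; exact Real.sqrt_le_sqrt hNR
    have hsq : √N * √N = N := Real.mul_self_sqrt hN0.le
    have hs0 : 0 < √N := Real.sqrt_pos.2 hN0
    have a1 : nm (κ z.1 w.1 - κ z'.1 w.1) ≤ C * r / (N * √N) := by
      have := tm_iter hC hκ z'.1 w.1 hlt (z'.1 - z.1).toNat
      rw [show z'.1 - ((z'.1 - z.1).toNat : ℤ) = z.1 by omega] at this
      refine this.trans ?_
      have hm : (((z'.1 - z.1).toNat : ℕ) : ℝ) ≤ r ^ 2 := by
        rw [← hR]; exact_mod_cast (show (z'.1 - z.1).toNat ≤ R by omega)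
      calc _ ≤ r ^ 2 * (C / N ^ 2) := mul_le_mul_of_nonneg_right hm (by positivity)
        _ = C * r * (r / N ^ 2) := by ring
        _ ≤ C * r * (1 / (N * √N)) := by
          refine mul_le_mul_of_nonneg_left ?_ (by positivity)
          rw [div_le_div_iff₀ (by positivity) (by positivity)]
          calc r * (N * √N) ≤ √N * (N * √N) := mul_le_mul_of_nonneg_right hsN (by positivity)
            _ = 1 * N ^ 2 := by rw [sq, mul_left_comm, hsq, one_mul]
        _ = _ := by ring
    have a2 : nm ((tau (z.2 - z'.2) - 1) * κ z'.1 w.1) ≤ C * d * r / (N * √N) := by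
      refine (hκ.sp _ _ hlt _).trans ?_
      calc _ ≤ C / (N * √N) * (d * r) := mul_le_mul_of_nonneg_left h3 (by positivity)
        _ = _ := by ring
    calc ∑ x ∈ s, |ker κ (w.1, x) z - ker κ (w.1, x) z'|
        ≤ ∑ x ∈ s, (|(κ z.1 w.1 - κ z'.1 w.1).coeff (x - z.2)| +
            |((tau (z.2 - z'.2) - 1) * κ z'.1 w.1).coeff (x - z'.2)|) := by
          refine Finset.sum_le_sum fun x _ => ?_
          refine le_trans (le_of_eq ?_) (abs_add_le _ _)
          rw [sub_mul, one_mul, AddMonoidAlgebra.coeff_sub, AddMonoidAlgebra.coeff_sub, Finsupp.sub_apply,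
            Finsupp.sub_apply, coeff_tau_mul, sub_sub_sub_cancel_right, sub_add_sub_cancel]
          rfl
      _ ≤ nm (κ z.1 w.1 - κ z'.1 w.1) + nm ((tau (z.2 - z'.2) - 1) * κ z'.1 w.1) := by
          rw [Finset.sum_add_distrib]
          exact add_le_add (coeff_sum_le_nm _ _ _) (coeff_sum_le_nm _ _ _)
      _ ≤ C * r / (N * √N) + C * d * r / (N * √N) := add_le_add a1 a2
      _ = _ := by ring
  · rw [← Finset.mul_sum]
    refine (mul_le_mul_of_nonneg_left (ser_b' _ _ R hR1 fun n hn => ?_) (by positivity)).trans (le_of_eq ?_)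
    · obtain ⟨w, hw, rfl⟩ := Finset.mem_image.1 hn
      exact hW w hw
    · rw [hsR]; field_simp

lemma hor_of {d : ℕ} {C : ℝ} {κ : ℤ → ℤ → RR d} (hC : 0 ≤ C) (hκ : KerEst C κ) (k : ℕ) (z z' : ℤ × (Fin d → ℤ))
    (hq : (dyZ d).Q k z = (dyZ d).Q k z') (W : Finset (ℤ × (Fin d → ℤ)))
    (hW : Disjoint W ((dyZ d).star k ((dyZ d).Q k z))) :
    ∑ w ∈ W, |ker κ w z - ker κ w z'| ≤ C * (10 + 2 * d) := by
  classical
  wlog hle : z.1 ≤ z'.1 generalizing z z'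
  · simp only [abs_sub_comm (ker κ _ z)]
    exact this z' z hq.symm (by rw [← hq]; exact hW) (le_of_not_ge hle)
  set c := (dyZ d).Q k z with hc
  have hz := ((dyZ d).mem k c z).2 rfl
  have hz' := ((dyZ d).mem k c z').2 hq.symm
  simp only [dyZ, Finset.mem_product, Fintype.mem_piFinset, Finset.mem_Ico] at hz hz'
  set R : ℕ := 4 ^ k with hR
  set r : ℝ := 2 ^ k with hr
  have hr0 : 0 < r := by positivity
  have hRr : (R : ℝ) = r ^ 2 := by rw [hR, hr, ← pow_mul, mul_comm, pow_mul]; norm_num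
  have hRZ : (4 : ℤ) ^ k = (R : ℤ) := by rw [hR]; push_cast; rfl
  rw [hRZ] at hz hz'
  have hfar : ∀ y : ℤ × (Fin d → ℤ), (c.1 * (R : ℤ) ≤ y.1 ∧ y.1 < (c.1 + 1) * (R : ℤ)) →
      (∀ i, c.2 i * 2 ^ k ≤ y.2 i ∧ y.2 i < (c.2 i + 1) * 2 ^ k) →
      ∀ w ∈ W, w.1 - z'.1 ≤ R → y.1 < w.1 → w.1 - y.1 ≤ (2 * R : ℕ) ∧ r ≤ l1 (w.2 - y.2) := by
    intro y hy hy2 w hw hw1 hw2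
    have e1 : (c.1 + 1) * (R : ℤ) = c.1 * R + R := by ring
    have hR0 : (0 : ℤ) ≤ R := by positivity
    refine ⟨by push_cast; omega, ?_⟩
    have hns : w ∉ (dyZ d).star k c := Finset.disjoint_left.1 hW hw
    simp only [dyZ, Finset.mem_product, Fintype.mem_piFinset, Finset.mem_Ico, hRZ] at hns
    have e2 : (c.1 - 3) * (R : ℤ) = c.1 * R - 3 * R := by ring
    have e3 : (c.1 + 4) * (R : ℤ) = c.1 * R + 4 * R := by ring
    have : ¬ ∀ i, (c.2 i - 1) * 2 ^ k ≤ w.2 i ∧ w.2 i < (c.2 i + 2) * 2 ^ k := fun h =>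
      hns ⟨⟨by omega, by omega⟩, h⟩
    push Not at this
    obtain ⟨i, hi⟩ := this
    have hi2 := hy2 i
    have h4 : (2 : ℤ) ^ k ≤ |(w.2 - y.2) i| := by
      rw [Pi.sub_apply]
      have e4 : (c.2 i + 1) * (2 : ℤ) ^ k = c.2 i * 2 ^ k + 2 ^ k := by ring
      have e5 : (c.2 i - 1) * (2 : ℤ) ^ k = c.2 i * 2 ^ k - 2 ^ k := by ring
      have e6 : (c.2 i + 2) * (2 : ℤ) ^ k = c.2 i * 2 ^ k + 2 * 2 ^ k := by ring
      rw [e4] at hi2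
      rw [e5, e6] at hi
      rw [le_abs]
      by_cases h5 : c.2 i * 2 ^ k - 2 ^ k ≤ w.2 i
      · have := hi h5; left; linarith
      · right; linarith
    have h5 : r ≤ |((w.2 - y.2) i : ℝ)| := by rw [hr]; exact_mod_cast h4
    exact h5.trans (Finset.single_le_sum (f := fun i => |((w.2 - y.2) i : ℝ)|) (fun _ _ => abs_nonneg _)
      (Finset.mem_univ i))
  have hs2 : √((2 * R : ℕ) : ℝ) ≤ 2 * r := by
    rw [Real.sqrt_le_left (by positivity)]
    push_cast; rw [hRr]; nlinarith
  have hfs : ∀ y : ℤ × (Fin d → ℤ), (c.1 * (R : ℤ) ≤ y.1 ∧ y.1 < (c.1 + 1) * (R : ℤ)) →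
      (∀ i, c.2 i * 2 ^ k ≤ y.2 i ∧ y.2 i < (c.2 i + 1) * 2 ^ k) →
      ∑ w ∈ W with w.1 - z'.1 ≤ R, |ker κ w y| ≤ 4 * C := fun y hy hy2 => by
    refine (hor_far hC hκ y (2 * R) r hr0 _ fun w hw hlt => hfar y hy hy2 w (Finset.mem_filter.1 hw).1
      (Finset.mem_filter.1 hw).2 hlt).trans ?_
    calc C / r * (2 * √((2 * R : ℕ) : ℝ)) ≤ C / r * (2 * (2 * r)) := by gcongr
      _ = 4 * C := by field_simp; ring
  have b1 := hfs z hz.1 hz.2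
  have b2 := hfs z' hz'.1 hz'.2
  have b3 : ∑ w ∈ W with ¬ (w.1 - z'.1 ≤ R), |ker κ w z - ker κ w z'| ≤ C * (1 + d) * 2 := by
    refine hor_near hC hκ z z' R r hr0 hRr _ hle ?_ ?_ fun w hw => not_le.1 (Finset.mem_filter.1 hw).2
    · have e1 : (c.1 + 1) * (R : ℤ) = c.1 * R + R := by ring
      omega
    · calc l1 (z.2 - z'.2) ≤ ∑ i : Fin d, r := by
            refine Finset.sum_le_sum fun i _ => ?_
            have h1 := hz.2 i
            have h2 := hz'.2 i
            have e4 : (c.2 i + 1) * (2 : ℤ) ^ k = c.2 i * 2 ^ k + 2 ^ k := by ring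
            rw [e4] at h1 h2
            have : |(z.2 - z'.2) i| ≤ 2 ^ k := by rw [Pi.sub_apply, abs_le]; constructor <;> linarith
            rw [hr]; exact_mod_cast this
        _ = d * r := by simp
  rw [← Finset.sum_filter_add_sum_filter_not W fun w => w.1 - z'.1 ≤ (R : ℤ)]
  have b4 : ∑ w ∈ W with w.1 - z'.1 ≤ R, |ker κ w z - ker κ w z'| ≤
      ∑ w ∈ W with w.1 - z'.1 ≤ R, |ker κ w z| + ∑ w ∈ W with w.1 - z'.1 ≤ R, |ker κ w z'| := by
    rw [← Finset.sum_add_distrib]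
    exact Finset.sum_le_sum fun w _ => abs_sub _ _
  linarith

def Bd {X : Type} (p C : ℝ) (K : X → X → ℝ) : Prop := ∀ (S W : Finset X) (f : X → ℝ),
  ∑ w ∈ W, |∑ z ∈ S, K w z * f z| ^ p ≤ C * ∑ z ∈ S, |f z| ^ p

def bar {d : ℕ} (z : ℤ × (Fin d → ℤ)) : ℤ × (Fin d → ℤ) := (-z.1, z.2)
lemma bar_bar {d : ℕ} (z : ℤ × (Fin d → ℤ)) : bar (bar z) = z := by simp [bar]
lemma bar_inj {d : ℕ} : Function.Injective (bar (d := d)) :=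
  Function.LeftInverse.injective (g := bar) bar_bar

lemma Bd.bar {d : ℕ} {p C : ℝ} {K : ℤ × (Fin d → ℤ) → ℤ × (Fin d → ℤ) → ℝ} (h : Bd p C K) :
    Bd p C (fun w z => K (bar w) (bar z)) := fun S W f => by
  classical
  have := h (S.image _root_.bar) (W.image _root_.bar) (fun z => f (_root_.bar z))
  rw [Finset.sum_image fun a _ b _ hab => bar_inj hab, Finset.sum_image fun a _ b _ hab => bar_inj hab] at this
  have e : ∀ w, ∑ z ∈ S.image _root_.bar, K w z * f (_root_.bar z) = ∑ z ∈ S, K w (_root_.bar z) * f z := fun w => by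
    rw [Finset.sum_image fun a _ b _ hab => bar_inj hab]
    simp only [bar_bar]
  simp only [e, bar_bar] at this
  exact this

lemma Bd.dual {X : Type} {p q C : ℝ} {K : X → X → ℝ} (h : Bd p C K) (hpq : p.HolderConjugate q) (hC : 0 < C) :
    Bd q (C ^ (q / p)) (fun w z => K z w) := fun S W f =>
  dual_est p q hpq C hC K W S (fun g => h W S g) f

lemma Bd_l2 {X : Type} {C : ℝ} {K : X → X → ℝ} : Bd 2 C K ↔
    ∀ (S W : Finset X) (f : X → ℝ), ∑ w ∈ W, (∑ z ∈ S, K w z * f z) ^ 2 ≤ C * ∑ z ∈ S, (f z) ^ 2 := by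
  simp only [Bd, Real.rpow_two, sq_abs]

lemma Bd.mono {X : Type} {p C C' : ℝ} {K : X → X → ℝ} (h : Bd p C K) (hC : C ≤ C') : Bd p C' K := fun S W f =>
  (h S W f).trans (mul_le_mul_of_nonneg_right hC (Finset.sum_nonneg fun _ _ => by positivity))

lemma coeff_sum' {d : ℕ} {ι : Type*} (s : Finset ι) (u : ι → RR d) (x : Fin d → ℤ) :
    (∑ i ∈ s, u i).coeff x = ∑ i ∈ s, (u i).coeff x := by
  simp only [← prg_ind, map_sum]

lemma coeff_mul_tau {d : ℕ} (v x : Fin d → ℤ) (u : RR d) (c : ℝ) :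
    (u * (c • tau v)).coeff x = u.coeff (x - v) * c := by
  rw [mul_smul_comm, AddMonoidAlgebra.coeff_smul, Finsupp.smul_apply, mul_comm u, coeff_tau_mul, smul_eq_mul, mul_comm]

lemma sqn_ge {d : ℕ} (u : RR d) (s : Finset (Fin d → ℤ)) : ∑ x ∈ s, (u.coeff x) ^ 2 ≤ sqn u := by
  classical
  rw [sqn_eq, Finsupp.sum]
  refine (Finset.sum_le_sum_of_subset_of_nonneg (Finset.subset_union_left (s₂ := u.coeff.support))
    fun x _ _ => sq_nonneg _).trans (le_of_eq ?_)
  refine (Finset.sum_subset Finset.subset_union_right fun j _ hj => ?_).symm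
  rw [Finsupp.notMem_support_iff.1 hj]; ring

lemma coeff_lin {d : ℕ} (Y : Finset (Fin d → ℤ)) (h : (Fin d → ℤ) → ℝ) (x : Fin d → ℤ) :
    (∑ y ∈ Y, h y • (tau y : RR d)).coeff x = if x ∈ Y then h x else 0 := by
  rw [← prg_ind, map_sum]
  simp only [map_smul, prg_tau, smul_eq_mul, mul_ite, mul_one, mul_zero, Finset.sum_ite_eq']

lemma sqn_lin {d : ℕ} (Y : Finset (Fin d → ℤ)) (h : (Fin d → ℤ) → ℝ) :
    sqn (∑ y ∈ Y, h y • (tau y : RR d)) = ∑ y ∈ Y, (h y) ^ 2 := by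
  rw [sqn_eq, Finsupp.sum]
  rw [Finset.sum_subset (s₂ := Y) (fun x hx => ?_) fun x _ hx => ?_]
  · exact Finset.sum_congr rfl fun x hx => by rw [coeff_lin, if_pos hx]
  · by_contra hh
    rw [Finsupp.mem_support_iff, coeff_lin, if_neg hh] at hx
    exact hx rfl
  · rw [Finsupp.notMem_support_iff.1 hx]; ring

lemma l2_ker {d : ℕ} (κ : ℤ → ℤ → RR d) (C : ℝ) (h : ∀ (J W : Finset ℤ) (f : ℤ → RR d),
        ∑ n ∈ W, sqn (∑ j ∈ J, κ j n * f j) ≤ C * ∑ j ∈ J, sqn (f j)) : Bd 2 C (ker κ) := by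
  classical
  rw [Bd_l2]
  intro S W f
  set F : ℤ × (Fin d → ℤ) → ℝ := fun z => if z ∈ S then f z else 0 with hF
  set J := S.image Prod.fst
  set Y := S.image Prod.snd
  have hSJ : S ⊆ J ×ˢ Y := fun z hz => Finset.mem_product.2
    ⟨Finset.mem_image_of_mem _ hz, Finset.mem_image_of_mem _ hz⟩
  have hsum : ∀ G : ℤ × (Fin d → ℤ) → ℝ → ℝ, (∀ z, G z 0 = 0) →
      ∑ z ∈ S, G z (f z) = ∑ j ∈ J, ∑ y ∈ Y, G (j, y) (F (j, y)) := fun G hG => by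
    rw [← Finset.sum_product' (f := fun j y => G (j, y) (F (j, y)))]
    rw [← Finset.sum_subset hSJ fun z _ hz => by simp only [hF]; rw [if_neg hz, hG]]
    exact Finset.sum_congr rfl fun z hz => by simp only [hF, Prod.mk.eta]; rw [if_pos hz]
  set u : ℤ → RR d := fun j => ∑ y ∈ Y, F (j, y) • (tau y : RR d) with hu
  have h1 := h J (W.image Prod.fst) u
  have e1 : ∑ j ∈ J, sqn (u j) = ∑ z ∈ S, (f z) ^ 2 := by
    rw [hsum (fun _ x => x ^ 2) fun _ => by ring]
    exact Finset.sum_congr rfl fun j _ => sqn_lin _ _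
  have e2 : ∀ n x, (∑ j ∈ J, κ j n * u j).coeff x = ∑ z ∈ S, ker κ (n, x) z * f z := fun n x => by
    rw [hsum (fun z t => ker κ (n, x) z * t) fun _ => by ring, coeff_sum']
    refine Finset.sum_congr rfl fun j _ => ?_
    simp only [hu]
    rw [Finset.mul_sum, coeff_sum']
    exact Finset.sum_congr rfl fun y _ => coeff_mul_tau _ _ _ _
  rw [e1] at h1
  refine le_trans ?_ h1
  refine slice W (fun w => (∑ z ∈ S, ker κ w z * f z) ^ 2) _ fun n _ s _ => ?_
  refine le_trans (le_of_eq ?_) (sqn_ge _ s)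
  simp only [e2]

lemma wn_cj {d : ℕ} (φ : (Fin d → ℤ) → ℝ) (hφ : ∀ x, φ (-x) = φ x) (u : RR d) : wn φ (cj u) = wn φ u := by
  have hc : ∀ x, (cj u).coeff x = u.coeff (-x) := fun x => by
    rw [← prg_ind, prg_cj, ← prg_ind]
    congr 2; ext y; simp only [neg_eq_iff_eq_neg]
  rw [wn_eq, prg_cj, wn_eq]
  congr 2; ext x
  rw [hc, neg_neg, hφ]

lemma coeff_cj {d : ℕ} (u : RR d) (x : Fin d → ℤ) : (cj u).coeff x = u.coeff (-x) := by
  rw [← prg_ind, prg_cj, ← prg_ind]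
  congr 2; ext y; simp only [neg_eq_iff_eq_neg]

lemma l1_neg {d : ℕ} (x : Fin d → ℤ) : l1 (-x) = l1 x := by simp [l1]
lemma nm_cj {d : ℕ} (u : RR d) : nm (cj u) = nm u := wn_cj _ (fun _ => rfl) u
lemma wt_cj {d : ℕ} (u : RR d) : wt (cj u) = wt u := wn_cj _ l1_neg u

def rev {d : ℕ} (κ : ℤ → ℤ → RR d) (j n : ℤ) : RR d := cj (κ (-n) (-j))

lemma KerEst.rev {d : ℕ} {C : ℝ} {κ : ℤ → ℤ → RR d} (h : KerEst C κ) : KerEst C (rev κ) where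
  zero j n hn := by rw [_root_.rev, h.zero _ _ (by omega), map_zero]
  sp j n hn v := by
    have := h.sp (-n) (-j) (by omega) (-v)
    rw [l1_neg, ← nm_cj, map_mul cj, map_sub cj, cj_tau, neg_neg, map_one, show -j - -n = n - j by ring] at this
    exact this
  mom j n hn := by
    have := h.mom (-n) (-j) (by omega)
    rw [← wt_cj, show -j - -n = n - j by ring] at this
    exact this
  tm j n hn := by
    have := h.tm' (-n) (-j) (by omega)
    rw [← nm_cj, map_sub cj, show -j - -n = n - j by ring, show -j + 1 = -(j - 1) by ring] at this
    exact this
  tm' j n hn := by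
    have := h.tm (-n) (-j) (by omega)
    rw [← nm_cj, map_sub cj, show -j - -n = n - j by ring, show -n - 1 = -(n + 1) by ring] at this
    exact this

lemma ker_rev {d : ℕ} (κ : ℤ → ℤ → RR d) (w z : ℤ × (Fin d → ℤ)) : ker (rev κ) w z = ker κ (bar z) (bar w) := by
  simp only [ker, rev, bar]
  rw [coeff_cj, neg_sub]

lemma Bd_all {d : ℕ} (C : ℝ) (hC : 0 < C) (p : ℝ) (hp : 1 < p) : ∃ C' : ℝ, 0 < C' ∧
    ∀ κ : ℤ → ℤ → RR d, KerEst C κ → Bd 2 C (ker κ) → Bd p C' (ker κ) := by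
  set C1 : ℝ := C * (10 + 2 * d) with hC1
  have hCC1 : C ≤ C1 := by
    have : (0 : ℝ) ≤ d := by positivity
    nlinarith
  have hC10 : 0 < C1 := hC.trans_le hCC1
  have mk : ∀ κ : ℤ → ℤ → RR d, KerEst C κ → Bd 2 C (ker κ) → CZK (dyZ d) C1 (ker κ) := fun κ h1 h2 =>
    ⟨Bd_l2.1 (h2.mono hCC1), fun k z z' hq W hW => hor_of hC.le h1 k z z' hq W hW⟩
  rcases le_or_gt p 2 with h2 | h2
  · obtain ⟨C', h0, h⟩ := strong_le (dyZ d) C1 hC10 p hp h2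
    exact ⟨C', h0, fun κ k1 k2 => h _ (mk κ k1 k2)⟩
  · have hpq := Real.HolderConjugate.conjExponent hp
    set q := p.conjExponent with hq
    have hq1 : 1 < q := hpq.symm.lt
    have hq2 : q ≤ 2 := by
      have := hpq.symm.sub_one_mul_conj
      nlinarith
    obtain ⟨C', h0, h⟩ := strong_le (dyZ d) C1 hC10 q hq1 hq2
    refine ⟨C' ^ (p / q), by positivity, fun κ k1 k2 => ?_⟩
    have hr : (fun w z => ker (rev κ) z w) = fun w z => ker κ (bar w) (bar z) := by
      funext w z; exact ker_rev _ _ _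
    have hr' : ker (rev κ) = fun w z => ker κ (bar z) (bar w) := by
      funext w z; exact ker_rev _ _ _
    have d1 : Bd 2 C (ker (rev κ)) := by
      have := k2.bar.dual Real.HolderConjugate.two_two hC
      rw [hr']
      simpa using this
    have d2 : Bd q C' (ker (rev κ)) := h _ (mk _ k1.rev d1)
    have d3 := d2.dual hpq.symm h0
    rw [hr] at d3
    have d4 := d3.bar
    simp only [bar_bar] at d4
    exact d4

lemma kap_est {d d₁ : ℕ} (hdd₁ : d ≤ d₁) (l : Fin d₁ → Fin d → ℤ)
    (hl : ∀ (k : Fin d₁) (hk : (k : ℕ) < d), l k = stdE d ⟨k, hk⟩)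
    (a b : ℝ) (ha : 0 < a) (hab : a ≤ b) (hb : 2 * d₁ * b < 1) (p : ℝ) (hp : 1 < p) :
    ∃ C : ℝ, 0 < C ∧ ∀ c : ℤ → Fin d₁ → ℝ, WB a b c → ∀ s t, Bd p C (ker (kap l c s t)) := by
  obtain ⟨C1, h1, H1⟩ := kerEst hdd₁ l hl a b ha hab hb
  obtain ⟨C2, h2, H2⟩ := L2_est hdd₁ l hl a b ha hab hb
  obtain ⟨C', h', H'⟩ := Bd_all (d := d) (max C1 C2) (lt_max_of_lt_left h1) p hp
  refine ⟨C', h', fun c hc s t => H' _ ?_ ((l2_ker _ C2 (H2 c hc s t)).mono (le_max_right _ _))⟩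
  have k := H1 c hc s t
  have hm : C1 ≤ max C1 C2 := le_max_left _ _
  have pos : ∀ j n : ℤ, j < n → (0 : ℝ) < ((n - j : ℤ) : ℝ) := fun j n h => by exact_mod_cast sub_pos.2 h
  refine ⟨k.zero, fun j n h v => (k.sp j n h v).trans ?_, fun j n h => (k.mom j n h).trans ?_,
    fun j n h => (k.tm j n h).trans ?_, fun j n h => (k.tm' j n h).trans ?_⟩
  · have h3 : 0 ≤ l1 v := Finset.sum_nonneg fun _ _ => abs_nonneg _
    have := pos j n h
    gcongr
  all_goals
    have := pos j n h
    gcongr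

lemma fdiff_coeff {d : ℕ} (i : Fin d) (u : RR d) :
    fdiff 1 (stdE d i) (fun x => u.coeff x) = fun x => (Dd i * u).coeff x := by
  funext x
  rw [fdiff, Dd, sub_mul, one_mul, AddMonoidAlgebra.coeff_sub, Finsupp.sub_apply, coeff_tau_mul,
    sub_neg_eq_add, div_one]

lemma fdiff_iter {d : ℕ} (i : Fin d) (k : ℕ) (u : RR d) :
    (fdiff 1 (stdE d i))^[k] (fun x => u.coeff x) = fun x => (Dd i ^ k * u).coeff x := by
  induction k with
  | zero => simp
  | succ k ih => rw [Function.iterate_succ_apply', ih, fdiff_coeff, ← mul_assoc, ← pow_succ']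

lemma mdiff_coeff {d : ℕ} (α : Fin d → ℕ) (u : RR d) :
    mdiff 1 α (fun x => u.coeff x) = fun x => ((∏ i, Dd i ^ α i) * u).coeff x := by
  rw [mdiff, Fin.prod_univ_def]
  induction List.finRange d with
  | nil => simp
  | cons i L ih => rw [List.foldr_cons, ih, fdiff_iter, List.map_cons, List.prod_cons, mul_assoc]

lemma prod_peel {d : ℕ} (α : Fin d → ℕ) (n : ℕ) (h : ∑ i, α i = n + 1) :
    ∃ (p : Fin d) (β : Fin d → ℕ), ∑ i, β i = n ∧
      ∏ i, (Dd i : RR d) ^ α i = Dd p * ∏ i, (Dd i : RR d) ^ β i := by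
  classical
  obtain ⟨p, _, hp⟩ : ∃ p ∈ Finset.univ, 0 < α p := by
    by_contra hh
    push Not at hh
    have := Finset.sum_nonpos hh
    omega
  have e : α = fun i => (if i = p then 1 else 0) + (α i - if i = p then 1 else 0) := by
    funext i
    split_ifs with hi
    · subst hi; omega
    · omega
  refine ⟨p, fun i => α i - if i = p then 1 else 0, ?_, ?_⟩
  · rw [e, Finset.sum_add_distrib] at h
    simp only [Finset.sum_ite_eq', Finset.mem_univ, if_true] at h
    beta_reduce
    omega
  · conv_lhs => rw [e]
    simp only [pow_add, Finset.prod_mul_distrib]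
    congr 1
    simp [pow_ite]

lemma mdiff_two {d : ℕ} (α : Fin d → ℕ) (h : ∑ i, α i = 2) :
    ∃ s t : Fin d, ∀ u : RR d, mdiff 1 α (fun x => u.coeff x) = fun x => (Dd s * Dd t * u).coeff x := by
  obtain ⟨s, β, hβ, e⟩ := prod_peel α 1 h
  obtain ⟨t, γ, hγ, e'⟩ := prod_peel β 0 hβ
  refine ⟨s, t, fun u => ?_⟩
  have hz : ∀ i, γ i = 0 := fun i => by
    have := Finset.single_le_sum (f := γ) (fun i _ => Nat.zero_le _) (Finset.mem_univ i)
    omega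
  rw [mdiff_coeff, e, e']
  simp [hz]

lemma G_eq {d d₁ : ℕ} (l : Fin d₁ → Fin d → ℤ) (ρ : ℝ) (lam : Fin d₁ → ℤ → ℝ)
    (G : ℤ → ℤ → (Fin d → ℤ) → ℝ)
    (h0 : ∀ (m : ℤ) (y : Fin d → ℤ), G m m y = if y = 0 then 1 else 0)
    (h1 : ∀ m nn : ℤ, m ≤ nn → ∀ y, G m (nn + 1) y =
          G m nn y + ρ * ∑ k, lam k nn * (G m nn (y + l k) - 2 * G m nn y + G m nn (y - l k)))
    (j n : ℤ) (hjn : j ≤ n) :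
    ∀ y, G j n y = (Prd l (fun i k => ρ * lam k i) j n).coeff y := by
  induction n, hjn using Int.leInduction with
  | base =>
    intro y
    rw [h0, Prd, Finset.Ico_self, Finset.prod_empty, ← tau_zero, tau, AddMonoidAlgebra.coeff_single,
      Finsupp.single_apply]
    simp only [eq_comm]
  | succ n hjn ih =>
    intro y
    rw [h1 j n hjn]
    simp only [ih]
    have e : Prd l (fun i k => ρ * lam k i) j (n + 1) =
        stp l (fun k => ρ * lam k n) * Prd l (fun i k => ρ * lam k i) j n := by
      rw [Prd_split l _ hjn (show n ≤ n + 1 by omega), mul_comm]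
      congr 1
      rw [Prd, show Finset.Ico n (n+1) = {n} by ext; simp; omega, Finset.prod_singleton]
    rw [e]
    generalize Prd l (fun i k => ρ * lam k i) j n = u
    rw [stp, add_mul, one_mul, Finset.sum_mul, AddMonoidAlgebra.coeff_add, Finsupp.add_apply, coeff_sum',
      Finset.mul_sum]
    congr 1
    refine Finset.sum_congr rfl fun k _ => ?_
    have : (ρ * lam k n) • (tau (l k) + tau (-l k) - 2) * u =
      (ρ * lam k n) • (tau (l k) * u + tau (-l k) * u - (u + u)) := by
      rw [smul_mul_assoc]; congr 1; ring
    rw [this, AddMonoidAlgebra.coeff_smul, Finsupp.smul_apply, AddMonoidAlgebra.coeff_sub, Finsupp.sub_apply,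
      AddMonoidAlgebra.coeff_add, AddMonoidAlgebra.coeff_add, Finsupp.add_apply, Finsupp.add_apply,
      coeff_tau_mul, coeff_tau_mul, sub_neg_eq_add, smul_eq_mul]
    ring

lemma inner_eq {d d₁ : ℕ} (l : Fin d₁ → Fin d → ℤ) (c : ℤ → Fin d₁ → ℝ)
    (G : ℤ → ℤ → (Fin d → ℤ) → ℝ)
    (hG : ∀ j n, j ≤ n → ∀ y, G j n y = (Prd l c j n).coeff y)
    (f : ℤ → (Fin d → ℤ) → ℝ) (S : Finset (ℤ × (Fin d → ℤ))) (hS : ∀ z, z ∉ S → f z.1 z.2 = 0) (nn : ℤ) :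
    (fun x => ∑' j : ℤ, if j < nn then ∑' y : Fin d → ℤ, G j nn (x - y) * f j y else 0) =
    fun x => (∑ z ∈ S, (if z.1 < nn then Prd l c z.1 nn else 0) * (f z.1 z.2 • tau z.2)).coeff x := by
  classical
  funext x
  rw [coeff_sum']
  simp only [coeff_mul_tau]
  have e1 : ∀ j, (∑' y : Fin d → ℤ, G j nn (x - y) * f j y) =
      ∑ y ∈ S.image Prod.snd, G j nn (x - y) * f j y := fun j => by
    refine tsum_eq_sum fun y hy => ?_
    rw [hS (j, y) fun h => hy (Finset.mem_image_of_mem Prod.snd h), mul_zero]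
  simp only [e1]
  rw [tsum_eq_sum (s := S.image Prod.fst)]
  · have e2 : ∀ j, (if j < nn then ∑ y ∈ S.image Prod.snd, G j nn (x - y) * f j y else 0) =
      ∑ y ∈ S.image Prod.snd, (if j < nn then Prd l c j nn else 0).coeff (x - y) * f j y := fun j => by
      split_ifs with h
      · exact Finset.sum_congr rfl fun y _ => by rw [hG j nn h.le]
      · simp
    simp only [e2]
    rw [← Finset.sum_product' (f := fun j y => (if j < nn then Prd l c j nn else 0).coeff (x - y) * f j y)]
    refine (Finset.sum_subset (fun z hz => ?_) fun z _ hz => ?_).symm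
    · exact Finset.mem_product.2 ⟨Finset.mem_image_of_mem _ hz, Finset.mem_image_of_mem _ hz⟩
    · rw [hS z hz, mul_zero]
  · intro j hj
    split_ifs
    · refine Finset.sum_eq_zero fun y _ => ?_
      rw [hS (j, y) fun h => hj (Finset.mem_image_of_mem Prod.fst h), mul_zero]
    · rfl

lemma diff_ker {d d₁ : ℕ} (l : Fin d₁ → Fin d → ℤ) (c : ℤ → Fin d₁ → ℝ) (s t : Fin d)
    (g : ℤ × (Fin d → ℤ) → ℝ) (S : Finset (ℤ × (Fin d → ℤ))) (nn : ℤ) (x : Fin d → ℤ) :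
    (Dd s * Dd t * ∑ z ∈ S, (if z.1 < nn then Prd l c z.1 nn else 0) * (g z • tau z.2)).coeff x =
      ∑ z ∈ S, ker (kap l c s t) (nn, x) z * g z := by
  rw [Finset.mul_sum, coeff_sum']
  refine Finset.sum_congr rfl fun z _ => ?_
  rw [← mul_assoc, coeff_mul_tau, ker, kap]
  simp only [mul_ite, mul_zero]

lemma Bd_tsum {X : Type} {p C : ℝ} {K : X → X → ℝ} (hC : 0 < C) (h : Bd p C K) (S : Finset X) (f : X → ℝ) :
    ∑' w, ENNReal.ofReal (|∑ z ∈ S, K w z * f z| ^ p) ≤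
      ENNReal.ofReal C * ∑' z, ENNReal.ofReal (|f z| ^ p) := by
  rw [ENNReal.tsum_eq_iSup_sum]
  refine iSup_le fun W => ?_
  rw [← ENNReal.ofReal_sum_of_nonneg fun _ _ => by positivity]
  refine (ENNReal.ofReal_le_ofReal (h S W f)).trans ?_
  rw [ENNReal.ofReal_mul hC.le, ENNReal.ofReal_sum_of_nonneg fun _ _ => by positivity]
  gcongr
  exact ENNReal.sum_le_tsum S

lemma lpN_pow {d : ℕ} (p : ℝ) (hp : 1 < p) (f : (Fin d → ℤ) → ℝ) :
    lpN p 1 f ^ p = ∑' x, ENNReal.ofReal (|f x| ^ p) := by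
  rw [lpN, ← ENNReal.rpow_mul, one_div, inv_mul_cancel₀ (by positivity), ENNReal.rpow_one]
  simp

lemma final_est {d d₁ : ℕ} (l : Fin d₁ → Fin d → ℤ) (c : ℤ → Fin d₁ → ℝ) (p C : ℝ) (hp : 1 < p) (hC : 0 < C)
    (hK : ∀ s t, Bd p C (ker (kap l c s t)))
    (g : ℤ × (Fin d → ℤ) → ℝ) (S : Finset (ℤ × (Fin d → ℤ))) (A : Finset (Fin d → Fin 3))
    (hA : A = Finset.univ.filter (fun α : Fin d → Fin (2 + 1) => (∑ i, (α i : ℕ)) = 2)) :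
    ∑' nn : ℤ, semiN p 1 2 (fun x => (∑ z ∈ S, (if z.1 < nn then Prd l c z.1 nn else 0) * (g z • tau z.2)).coeff x) ^ p
      ≤ ENNReal.ofReal (((A.card : ℝ) + 1) ^ (p - 1) * ((A.card + 1) * C)) * ∑' z, ENNReal.ofReal (|g z| ^ p) := by
  have h1 : ∀ nn : ℤ, semiN p 1 2 (fun x => (∑ z ∈ S, (if z.1 < nn then Prd l c z.1 nn else 0) * (g z • tau z.2)).coeff x) ^ p
      ≤ (A.card : ℝ≥0∞) ^ (p - 1) * ∑ α ∈ A, lpN p 1 (mdiff 1 (fun i => (α i : ℕ))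
        (fun x => (∑ z ∈ S, (if z.1 < nn then Prd l c z.1 nn else 0) * (g z • tau z.2)).coeff x)) ^ p := fun nn => by
    rw [semiN, ← hA]
    exact ENNReal.rpow_sum_le_const_mul_sum_rpow _ _ hp.le
  refine (ENNReal.tsum_le_tsum h1).trans ?_
  rw [ENNReal.tsum_mul_left, Summable.tsum_finsetSum fun _ _ => ENNReal.summable]
  have h2 : ∀ α ∈ A, ∑' nn : ℤ, lpN p 1 (mdiff 1 (fun i => (α i : ℕ))
        (fun x => (∑ z ∈ S, (if z.1 < nn then Prd l c z.1 nn else 0) * (g z • tau z.2)).coeff x)) ^ p ≤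
        ENNReal.ofReal C * ∑' z, ENNReal.ofReal (|g z| ^ p) := fun α hα => by
    rw [hA, Finset.mem_filter] at hα
    obtain ⟨s, t, hst⟩ := mdiff_two (fun i => (α i : ℕ)) hα.2
    simp only [hst, lpN_pow p hp, diff_ker]
    rw [← ENNReal.tsum_prod (f := fun nn x => ENNReal.ofReal (|∑ z ∈ S, ker (kap l c s t) (nn, x) z * g z| ^ p))]
    exact Bd_tsum hC (hK s t) S g
  refine (mul_le_mul_right (Finset.sum_le_sum h2) _).trans ?_
  rw [Finset.sum_const, nsmul_eq_mul, ← mul_assoc, ← mul_assoc]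
  gcongr
  rw [ENNReal.ofReal_mul (by positivity), ENNReal.ofReal_mul (by positivity), ← mul_assoc,
    ← ENNReal.ofReal_rpow_of_nonneg (by positivity) (by linarith)]
  have hc : (A.card : ℝ≥0∞) ≤ ENNReal.ofReal ((A.card : ℝ) + 1) := by
    rw [← ENNReal.ofReal_natCast]; exact ENNReal.ofReal_le_ofReal (by linarith)
  gcongr

/-- Theorem 4.3: discrete parabolic Calderón–Zygmund estimate. -/
theorem discrete_calderon_zygmund
    (d d₁ : ℕ) (hd : 1 ≤ d) (hdd₁ : d ≤ d₁)
    (l : Fin d₁ → Fin d → ℤ) (hl : ∀ (k : Fin d₁) (hk : (k : ℕ) < d), l k = stdE d ⟨k, hk⟩)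
    (δ₁ δ₂ : ℝ) (hδ₁ : 0 < δ₁) (hδ₁₂ : δ₁ ≤ δ₂)
    (ρ : ℝ) (hρ : 0 < ρ) (hρ' : ρ < (2 * d₁ * δ₂)⁻¹)
    (p : ℝ) (hp : 1 < p) :
    ∃ N : ℝ, 0 < N ∧
      ∀ lam : Fin d₁ → ℤ → ℝ, (∀ k t, lam k t ∈ Set.Icc δ₁ δ₂) →
      ∀ G : ℤ → ℤ → (Fin d → ℤ) → ℝ,
        (∀ (m : ℤ) (y : Fin d → ℤ), G m m y = if y = 0 then 1 else 0) →
        (∀ m nn : ℤ, m ≤ nn → ∀ y, G m (nn + 1) y =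
          G m nn y + ρ * ∑ k, lam k nn * (G m nn (y + l k) - 2 * G m nn y + G m nn (y - l k))) →
      ∀ f : ℤ → (Fin d → ℤ) → ℝ,
        (Function.support fun q : ℤ × (Fin d → ℤ) => f q.1 q.2).Finite →
        ∑' nn : ℤ,
            semiN p 1 2
              (fun x => ∑' j : ℤ, if j < nn then ∑' y : Fin d → ℤ, G j nn (x - y) * f j y else 0)
              ^ p ≤
          ENNReal.ofReal N * ∑' q : ℤ × (Fin d → ℤ), ENNReal.ofReal (|f q.1 q.2| ^ p) := by
  have hd₁ : (0 : ℝ) < d₁ := by exact_mod_cast (show 0 < d₁ by omega)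
  have hδ₂ : 0 < δ₂ := hδ₁.trans_le hδ₁₂
  have hb : 2 * (d₁ : ℝ) * (ρ * δ₂) < 1 := by
    have := mul_lt_mul_of_pos_right hρ' (show 0 < 2 * (d₁ : ℝ) * δ₂ by positivity)
    rw [inv_mul_cancel₀ (by positivity)] at this
    linarith
  obtain ⟨C, hC, hK⟩ := kap_est hdd₁ l hl (ρ * δ₁) (ρ * δ₂) (mul_pos hρ hδ₁)
    (mul_le_mul_of_nonneg_left hδ₁₂ hρ.le) hb p hp
  obtain ⟨A, hA⟩ : ∃ A : Finset (Fin d → Fin 3), A = Finset.univ.filter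
      (fun α : Fin d → Fin (2 + 1) => (∑ i, (α i : ℕ)) = 2) := ⟨_, rfl⟩
  refine ⟨((A.card : ℝ) + 1) ^ (p - 1) * ((A.card + 1) * C), by positivity, fun lam hlam G h0 h1 f hf => ?_⟩
  · have hG := G_eq l ρ lam G h0 h1
    have hS : ∀ z, z ∉ hf.toFinset → f z.1 z.2 = 0 := fun z hz => by
      by_contra hh
      exact hz (hf.mem_toFinset.2 hh)
    simp only [inner_eq l (fun i k => ρ * lam k i) G hG f hf.toFinset hS]
    exact final_est l (fun i k => ρ * lam k i) p C hp hC
      (hK _ fun i k => ⟨mul_le_mul_of_nonneg_left (hlam k i).1 hρ.le, mul_le_mul_of_nonneg_left (hlam k i).2 hρ.le⟩)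
      (fun z => f z.1 z.2) hf.toFinset A hA
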